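/- Characterisation of the duality operations: suppose {𝔻_n}_{n≥0} is a collection of ℂ-linear endomorphisms 𝔻_n : C_n → C_n such that (i) 𝔻_0 = id on C_0 = ℂ and 𝔻_{n₁+n₂}(R^{n₁+n₂}_{n₁,n₂}(f₁ ⊠ f₂)) = R^{n₁+n₂}_{n₁,n₂}(𝔻_{n₁}(f₁) ⊠ 𝔻_{n₂}(f₂)) for all n₁, n₂ ≥ 1 and f_i ∈ C_{n_i}, and (ii) 𝔻_n(f) = (-1)^{n-1} f for every pre-cuspidal f ∈ C_n and every n ≥ 1. Then 𝔻_n = 𝒟_n for every n ≥ 0; in particular such a collection exists and is unique. -/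

import Mathlib

open Matrix BigOperators

namespace HCPaper

open scoped Classical

/-- `gl F n` : the additive group of `n × n` matrices over `F`. -/
abbrev gl (F : Type) (n : ℕ) := Matrix (Fin n) (Fin n) F

variable {F : Type} [Field F] [Fintype F] [DecidableEq F]

/-- Conjugation (adjoint) action of `GL_n(F)` on `gl_n(F)`. -/
def conjM {n : ℕ} (g : Matrix.GeneralLinearGroup (Fin n) F) (x : gl F n) : gl F n :=
  (g : Matrix (Fin n) (Fin n) F) * x * ((g⁻¹ : Matrix.GeneralLinearGroup (Fin n) F) : Matrix (Fin n) (Fin n) F)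

/-- A function `f : gl_n(F) → ℂ` is invariant if it is constant on `GL_n(F)`-conjugacy orbits. -/
def Invariant (n : ℕ) (f : gl F n → ℂ) : Prop :=
  ∀ (g : Matrix.GeneralLinearGroup (Fin n) F) (x : gl F n), f (conjM g x) = f x

/-- Invariance for functions on `gl_k(F) × gl_l(F)` under `GL_k(F) × GL_l(F)`. -/
def Invariant₂ (k l : ℕ) (h : gl F k × gl F l → ℂ) : Prop :=
  ∀ (g₁ : Matrix.GeneralLinearGroup (Fin k) F) (g₂ : Matrix.GeneralLinearGroup (Fin l) F)
    (x : gl F k) (y : gl F l), h (conjM g₁ x, conjM g₂ y) = h (x, y)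

/-- Transport of matrices along an equality of sizes. -/
def castM {m n : ℕ} (h : m = n) (x : gl F m) : gl F n :=
  Matrix.reindex (finCongr h) (finCongr h) x

/-- Transport of functions along an equality of sizes. -/
def castFun {m n : ℕ} (h : m = n) (f : gl F m → ℂ) : gl F n → ℂ :=
  fun x => f (castM h.symm x)

/-- The block upper-triangular matrix `[x u; 0 y]`, viewed in `gl_{k+l}(F)`. -/
def but (k l : ℕ) (x : gl F k) (u : Matrix (Fin k) (Fin l) F) (y : gl F l) : gl F (k + l) :=
  Matrix.reindex finSumFinEquiv finSumFinEquiv (Matrix.fromBlocks x u 0 y)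

/-- The block lower-triangular matrix `[x 0; v y]`, viewed in `gl_{k+l}(F)`. -/
def blt (k l : ℕ) (x : gl F k) (v : Matrix (Fin l) (Fin k) F) (y : gl F l) : gl F (k + l) :=
  Matrix.reindex finSumFinEquiv finSumFinEquiv (Matrix.fromBlocks x 0 v y)

/-- View a matrix in `gl_{k+l}(F)` as a `2 × 2`-block matrix. -/
def blk (k l : ℕ) (m : gl F (k + l)) : Matrix (Fin k ⊕ Fin l) (Fin k ⊕ Fin l) F :=
  Matrix.reindex finSumFinEquiv.symm finSumFinEquiv.symm m

/-- Membership in `P_{k,l}` : being block upper triangular with blocks of sizes `k, l`. -/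
def IsBUT (k l : ℕ) (m : gl F (k + l)) : Prop := Matrix.toBlocks₂₁ (blk k l m) = 0

/-- The projection `π : P_{k,l} → gl_k(F) × gl_l(F)` deleting the off-diagonal block. -/
def proj (k l : ℕ) (m : gl F (k + l)) : gl F k × gl F l :=
  (Matrix.toBlocks₁₁ (blk k l m), Matrix.toBlocks₂₂ (blk k l m))

/-- The order of the group `P^×_{k,l}` of invertible block upper-triangular matrices. -/
noncomputable def Pcard (F : Type) [Field F] [Fintype F] [DecidableEq F] (k l : ℕ) : ℕ :=
  Nat.card {g : Matrix.GeneralLinearGroup (Fin (k + l)) F //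
    IsBUT k l (g : Matrix (Fin (k + l)) (Fin (k + l)) F)}

/-- Harish-Chandra restriction `*R^{k+l}_{k,l}`; by convention it is the identity
(under the canonical identifications) when `k = 0` or `l = 0`. -/
noncomputable def HCres (k l : ℕ) (f : gl F (k + l) → ℂ) : gl F k × gl F l → ℂ :=
  if hk : k = 0 then fun p => f (castM (by omega) p.2)
  else if hl : l = 0 then fun p => f (castM (by omega) p.1)
  else fun p =>
    ((Fintype.card F : ℂ) ^ (k * l))⁻¹ * ∑ u : Matrix (Fin k) (Fin l) F, f (but k l p.1 u p.2)

/-- Harish-Chandra induction `R^{k+l}_{k,l}`; by convention it is the identity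
(under the canonical identifications) when `k = 0` or `l = 0`. -/
noncomputable def HCind (k l : ℕ) (h : gl F k × gl F l → ℂ) : gl F (k + l) → ℂ :=
  if hk : k = 0 then fun z => h (0, castM (by omega) z)
  else if hl : l = 0 then fun z => h (castM (by omega) z, 0)
  else fun z =>
    ((Pcard F k l : ℂ))⁻¹ *
      ∑ g : Matrix.GeneralLinearGroup (Fin (k + l)) F,
        if IsBUT k l (conjM g z) then h (proj k l (conjM g z)) else 0

/-- The hermitian inner product on `C_n`. -/
noncomputable def inn (n : ℕ) (f g : gl F n → ℂ) : ℂ :=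
  ((Fintype.card (Matrix.GeneralLinearGroup (Fin n) F) : ℂ))⁻¹ *
    ∑ x : gl F n, f x * (starRingEnd ℂ) (g x)

/-- The hermitian inner product on invariant functions on `gl_k(F) × gl_l(F)`. -/
noncomputable def inn₂ (k l : ℕ) (f g : gl F k × gl F l → ℂ) : ℂ :=
  ((Fintype.card (Matrix.GeneralLinearGroup (Fin k) F) *
      Fintype.card (Matrix.GeneralLinearGroup (Fin l) F) : ℂ))⁻¹ *
    ∑ p : gl F k × gl F l, f p * (starRingEnd ℂ) (g p)

/-- `f ∈ C_n` is pre-cuspidal if all proper Harish-Chandra restrictions of `f` vanish. -/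
def PreCuspidal (n : ℕ) (f : gl F n → ℂ) : Prop :=
  ∀ (k l : ℕ), 1 ≤ k → 1 ≤ l → ∀ hkl : k + l = n, HCres k l (castFun hkl.symm f) = 0

/-- The composite `R_{(n_1,…,n_r)} ∘ *R_{(n_1,…,n_r)}` of the iterated two-block
Harish-Chandra induction and restriction along the composition `(n_1,…,n_r)`. -/
noncomputable def RcompRes : (L : List ℕ) → (gl F L.sum → ℂ) → gl F L.sum → ℂ
  | [], f => f
  | (k :: L), f =>
      castFun (List.sum_cons).symm
        (HCind k L.sum fun p =>
          RcompRes L (fun y => HCres k L.sum (castFun List.sum_cons f) (p.1, y)) p.2)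

/-- The duality operation `𝒟_n(f) = Σ_{(n_1,…,n_r) ⊨ n} (-1)^{n-r}
R_{(n_1,…,n_r)}(*R_{(n_1,…,n_r)} f)`, the sum over all compositions of `n`. -/
noncomputable def Dual (n : ℕ) (f : gl F n → ℂ) : gl F n → ℂ :=
  ∑ c : Composition n,
    ((-1 : ℂ)) ^ (n - c.length) •
      castFun c.blocks_sum (RcompRes c.blocks (castFun c.blocks_sum.symm f))

/-- `C_n`, the subspace of invariant functions, as a `ℂ`-submodule of all functions. -/
noncomputable def InvSub (F : Type) [Field F] (n : ℕ) : Submodule ℂ (gl F n → ℂ) where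
  carrier := {f | Invariant n f}
  add_mem' := by
    intro a b ha hb g x
    simp only [Pi.add_apply]
    rw [ha g x, hb g x]
  zero_mem' := by intro g x; rfl
  smul_mem' := by
    intro c f hf g x
    simp only [Pi.smul_apply]
    rw [hf g x]

/-- `χ` is the character of a finite-dimensional complex representation of the
additive group `gl_n(F)`. -/
def IsChar (n : ℕ) (χ : gl F n → ℂ) : Prop :=
  ∃ V : FDRep ℂ (Multiplicative (gl F n)),
    ∀ x : gl F n, FDRep.character V (Multiplicative.ofAdd x) = χ x

/-- An invariant character of `gl_n(F)`. -/
def IsInvChar (n : ℕ) (χ : gl F n → ℂ) : Prop := IsChar n χ ∧ Invariant n χ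

/-- A character of the additive group `gl_k(F) × gl_l(F)`. -/
def IsChar₂ (k l : ℕ) (χ : gl F k × gl F l → ℂ) : Prop :=
  ∃ V : FDRep ℂ (Multiplicative (gl F k × gl F l)),
    ∀ p : gl F k × gl F l, FDRep.character V (Multiplicative.ofAdd p) = χ p

/-- An invariant character of `gl_k(F) × gl_l(F)`. -/
def IsInvChar₂ (k l : ℕ) (χ : gl F k × gl F l → ℂ) : Prop := IsChar₂ k l χ ∧ Invariant₂ k l χ

/-- An irreducible invariant character: a nonzero invariant character which is not
the sum of two nonzero invariant characters. -/
def IrrInvChar (n : ℕ) (χ : gl F n → ℂ) : Prop :=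
  IsInvChar n χ ∧ χ ≠ 0 ∧
    ¬ ∃ χ₁ χ₂ : gl F n → ℂ, IsInvChar n χ₁ ∧ IsInvChar n χ₂ ∧ χ₁ ≠ 0 ∧ χ₂ ≠ 0 ∧ χ = χ₁ + χ₂



set_option linter.unusedSectionVars false

/-! ### Pairs (vector space, endomorphism) -/

/-- A finite vector space together with an endomorphism. -/
structure Obj (F : Type) [Field F] where
  V : Type
  [grp : AddCommGroup V]
  [mod : Module F V]
  [fin : Finite V]
  T : V →ₗ[F] V

attribute [instance] Obj.grp Obj.mod Obj.fin

instance quoFinite (V : Type) [AddCommGroup V] [Module F V] [Finite V] (W : Submodule F V) :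
    Finite (V ⧸ W) := Finite.of_surjective _ (Submodule.mkQ_surjective W)

/-- Isomorphism of pairs. -/
def Iso (X Y : Obj F) : Prop := ∃ e : X.V ≃ₗ[F] Y.V, ∀ v, e (X.T v) = Y.T (e v)

theorem Iso.rfl' (X : Obj F) : Iso X X := ⟨LinearEquiv.refl F X.V, fun _ => rfl⟩

theorem Iso.symm {X Y : Obj F} (h : Iso X Y) : Iso Y X := by
  obtain ⟨e, he⟩ := h
  refine ⟨e.symm, fun v => ?_⟩
  apply e.injective
  rw [he]; simp

theorem Iso.trans {X Y Z : Obj F} (h : Iso X Y) (h' : Iso Y Z) : Iso X Z := by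
  obtain ⟨e, he⟩ := h
  obtain ⟨e', he'⟩ := h'
  exact ⟨e.trans e', fun v => by simp [he, he']⟩

/-- Functions on pairs that are constant on isomorphism classes. -/
def IsCF (f : Obj F → ℂ) : Prop := ∀ X Y : Obj F, Iso X Y → f X = f Y

/-- Stable subspaces. -/
@[ext]
structure Inv (X : Obj F) : Type where
  W : Submodule F X.V
  st : ∀ v ∈ W, X.T v ∈ W

/-- The sub-object. -/
abbrev Obj.sub (X : Obj F) (W : Inv X) : Obj F := ⟨W.1, X.T.restrict W.2⟩

/-- The quotient object. -/
abbrev Obj.quo (X : Obj F) (W : Inv X) : Obj F := ⟨X.V ⧸ W.1, W.1.mapQ W.1 X.T W.2⟩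

/-- Dimension. -/
noncomputable def dm (X : Obj F) : ℕ := Module.finrank F X.V

instance homFinite (V W : Type) [AddCommGroup V] [AddCommGroup W] [Module F V] [Module F W]
    [Finite V] [Finite W] : Finite (V →ₗ[F] W) :=
  DFunLike.finite _

noncomputable instance homFintype (V W : Type) [AddCommGroup V] [AddCommGroup W] [Module F V]
    [Module F W] [Finite V] [Finite W] : Fintype (V →ₗ[F] W) := Fintype.ofFinite _

noncomputable instance subFintype (V : Type) [AddCommGroup V] [Module F V]
    [Finite V] : Fintype (Submodule F V) := Fintype.ofFinite _

instance (X : Obj F) : Finite (Inv X) :=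
  Finite.of_injective Inv.W fun _ _ h => Inv.ext h

noncomputable instance (X : Obj F) : Fintype (Inv X) := Fintype.ofFinite _

theorem Iso.dm_eq {X Y : Obj F} (h : Iso X Y) : dm X = dm Y := by
  obtain ⟨e, _⟩ := h
  exact e.finrank_eq

theorem dm_sub (X : Obj F) (W : Inv X) : dm (X.sub W) = Module.finrank F W.1 := rfl

theorem dm_quo (X : Obj F) (W : Inv X) : dm (X.quo W) + dm (X.sub W) = dm X :=
  Submodule.finrank_quotient_add_finrank W.1

theorem iso_quo (X Y : Obj F) (W : Inv X) (φ : X.V →ₗ[F] Y.V) (hs : Function.Surjective φ)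
    (hk : ∀ v, φ v = 0 ↔ v ∈ W.1) (hc : ∀ v, φ (X.T v) = Y.T (φ v)) : Iso (X.quo W) Y := by
  have hk' : W.1 = LinearMap.ker φ := by ext v; simp [hk]
  refine ⟨(Submodule.quotEquivOfEq _ _ hk').trans (φ.quotKerEquivOfSurjective hs), ?_⟩
  intro v
  obtain ⟨v, rfl⟩ := Submodule.mkQ_surjective _ v
  exact hc v

theorem iso_sub (X Y : Obj F) (W : Inv Y) (φ : X.V →ₗ[F] Y.V) (hs : Function.Injective φ)
    (hk : ∀ v, v ∈ W.1 ↔ ∃ u, φ u = v) (hc : ∀ v, φ (X.T v) = Y.T (φ v)) : Iso X (Y.sub W) := by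
  have hk' : LinearMap.range φ = W.1 := by ext v; simp [hk]
  refine ⟨(LinearEquiv.ofInjective φ hs).trans (LinearEquiv.ofEq _ _ hk'), ?_⟩
  intro v
  exact Subtype.ext (hc v)

/-- Transport of stable subspaces along isomorphism. -/
theorem Iso.sum_inv {X Y : Obj F} (h : Iso X Y) (H : Obj F → Obj F → ℂ)
    (h1 : ∀ A A' B, Iso A A' → H A B = H A' B) (h2 : ∀ A, IsCF (H A)) :
    ∑ W : Inv X, H (X.sub W) (X.quo W) = ∑ W : Inv Y, H (Y.sub W) (Y.quo W) := by
  obtain ⟨e, he⟩ := h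
  have he' : ∀ v, e.symm (Y.T v) = X.T (e.symm v) := fun v => by
    apply e.injective; rw [he]; simp
  let E : Inv X ≃ Inv Y :=
    { toFun := fun W => ⟨W.1.map e.toLinearMap, by
        rintro _ ⟨v, hv, rfl⟩
        exact ⟨X.T v, W.2 v hv, he v⟩⟩
      invFun := fun W => ⟨W.1.comap e.toLinearMap, by
        intro v hv
        have := W.2 _ hv
        simp only [Submodule.mem_comap, LinearEquiv.coe_coe] at this ⊢
        rw [he]; exact this⟩
      left_inv := fun W => Inv.ext (Submodule.comap_map_eq_of_injective e.injective _)
      right_inv := fun W => Inv.ext (Submodule.map_comap_eq_of_surjective e.surjective _) }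
  refine Fintype.sum_equiv E _ _ fun W => ?_
  have i1 : Iso (X.sub W) (Y.sub (E W)) := by
    refine iso_sub _ _ _ (e.toLinearMap ∘ₗ W.1.subtype) ?_ ?_ ?_
    · exact e.injective.comp Subtype.val_injective
    · intro v
      constructor
      · rintro ⟨u, hu, rfl⟩
        exact ⟨⟨u, hu⟩, rfl⟩
      · rintro ⟨u, rfl⟩
        exact ⟨u.1, u.2, rfl⟩
    · intro v
      exact he v.1
  have i2 : Iso (X.quo W) (Y.quo (E W)) := by
    refine iso_quo _ _ _ ((E W).1.mkQ ∘ₗ e.toLinearMap) ?_ ?_ ?_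
    · exact (Submodule.mkQ_surjective _).comp e.surjective
    · intro v
      change Submodule.Quotient.mk (e v) = 0 ↔ _
      rw [Submodule.Quotient.mk_eq_zero]
      constructor
      · rintro ⟨u, hu, h⟩
        rwa [← e.injective h]
      · intro h
        exact ⟨v, h, rfl⟩
    · intro v
      change Submodule.Quotient.mk (e (X.T v)) = Submodule.Quotient.mk (Y.T (e v))
      rw [he]
  rw [h1 _ _ _ i1, h2 _ _ _ i2]

/-! ### Product -/

/-- The (Hall algebra) product. -/
noncomputable def hm (f g : Obj F → ℂ) : Obj F → ℂ :=
  fun X => ∑ W : Inv X, f (X.sub W) * g (X.quo W)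

theorem hm_isCF {f g : Obj F → ℂ} (hf : IsCF f) (hg : IsCF g) : IsCF (hm f g) := by
  intro X Y h
  exact h.sum_inv (fun A B => f A * g B) (fun A A' B h => by simp only [hf _ _ h])
    (fun A B B' h => by simp only [hg _ _ h])

/-- Intersection with `E`. -/
def Inv.down {X : Obj F} (U E : Inv X) : Inv (X.sub E) :=
  ⟨U.1.comap E.1.subtype, fun v hv => U.2 v.1 hv⟩

/-- Image in `X/U`. -/
def Inv.up {X : Obj F} (U E : Inv X) : Inv (X.quo U) :=
  ⟨E.1.map U.1.mkQ, by
    rintro _ ⟨v, hv, rfl⟩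
    exact ⟨X.T v, E.2 v hv, rfl⟩⟩

theorem sum_sub (X : Obj F) (E : Inv X) (G : Inv (X.sub E) → ℂ) :
    ∑ U, G U = ∑ U : Inv X, if U.1 ≤ E.1 then G (U.down E) else 0 := by
  rw [← Finset.sum_filter]
  symm
  refine Finset.sum_bij (fun U _ => U.down E) (fun _ _ => Finset.mem_univ _) ?_ ?_ (fun _ _ => rfl)
  · intro U hU U' hU' h
    simp only [Finset.mem_filter, Finset.mem_univ, true_and] at hU hU'
    apply Inv.ext
    have h' : U.1.comap E.1.subtype = U'.1.comap E.1.subtype := congrArg Inv.W h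
    have := congrArg (Submodule.map E.1.subtype) h'
    rwa [Submodule.map_comap_subtype, Submodule.map_comap_subtype, inf_eq_right.2 hU,
      inf_eq_right.2 hU'] at this
  · intro U _
    refine ⟨⟨U.1.map E.1.subtype, ?_⟩, ?_, ?_⟩
    · rintro _ ⟨v, hv, rfl⟩
      exact ⟨_, U.2 v hv, rfl⟩
    · refine Finset.mem_filter.2 ⟨Finset.mem_univ _, ?_⟩
      exact Submodule.map_subtype_le _ _
    · exact Inv.ext (Submodule.comap_map_eq_of_injective Subtype.val_injective _)

theorem sum_quo (X : Obj F) (U : Inv X) (G : Inv (X.quo U) → ℂ) :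
    ∑ E, G E = ∑ E : Inv X, if U.1 ≤ E.1 then G (U.up E) else 0 := by
  rw [← Finset.sum_filter]
  symm
  refine Finset.sum_bij (fun E _ => U.up E) (fun _ _ => Finset.mem_univ _) ?_ ?_ (fun _ _ => rfl)
  · intro E hU E' hU' h
    simp only [Finset.mem_filter, Finset.mem_univ, true_and] at hU hU'
    apply Inv.ext
    have h' : E.1.map U.1.mkQ = E'.1.map U.1.mkQ := congrArg Inv.W h
    have := congrArg (Submodule.comap U.1.mkQ) h'
    rwa [Submodule.comap_map_mkQ, Submodule.comap_map_mkQ, sup_eq_right.2 hU,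
      sup_eq_right.2 hU'] at this
  · intro E _
    refine ⟨⟨E.1.comap U.1.mkQ, ?_⟩, ?_, ?_⟩
    · intro v hv
      exact E.2 _ hv
    · refine Finset.mem_filter.2 ⟨Finset.mem_univ _, ?_⟩
      exact Submodule.le_comap_mkQ _ _
    · exact Inv.ext (Submodule.map_comap_eq_of_surjective (Submodule.mkQ_surjective _) _)

theorem iso_sub_down {X : Obj F} (U E : Inv X) (h : U.1 ≤ E.1) :
    Iso ((X.sub E).sub (U.down E)) (X.sub U) := by
  refine iso_sub _ _ _ (E.1.subtype ∘ₗ (U.down E).1.subtype) ?_ ?_ ?_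
  · exact Subtype.val_injective.comp Subtype.val_injective
  · intro v
    constructor
    · intro hv
      exact ⟨⟨⟨v, h hv⟩, hv⟩, rfl⟩
    · rintro ⟨u, rfl⟩
      exact u.2
  · intro v
    rfl

theorem iso_quo_down {X : Obj F} (U E : Inv X) :
    Iso ((X.sub E).quo (U.down E)) ((X.quo U).sub (U.up E)) := by
  refine iso_quo _ _ _
    (LinearMap.codRestrict (U.up E).1 (U.1.mkQ ∘ₗ E.1.subtype) fun v => ⟨v.1, v.2, rfl⟩) ?_ ?_ ?_
  · rintro ⟨_, v, hv, rfl⟩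
    exact ⟨⟨v, hv⟩, rfl⟩
  · intro v
    refine Subtype.ext_iff.trans ?_
    change Submodule.Quotient.mk v.1 = 0 ↔ v.1 ∈ U.1
    rw [Submodule.Quotient.mk_eq_zero]
  · intro v
    rfl

theorem iso_quo_up {X : Obj F} (U E : Inv X) (h : U.1 ≤ E.1) :
    Iso (X.quo E) ((X.quo U).quo (U.up E)) := by
  refine iso_quo _ _ _ ((U.up E).1.mkQ ∘ₗ U.1.mkQ) ?_ ?_ ?_
  · exact (Submodule.mkQ_surjective _).comp (Submodule.mkQ_surjective _)
  · intro v
    refine (Submodule.Quotient.mk_eq_zero _).trans ?_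
    change v ∈ (E.1.map U.1.mkQ).comap U.1.mkQ ↔ _
    rw [Submodule.comap_map_mkQ, sup_eq_right.2 h]
  · intro v
    rfl

theorem sum_chain_sub (X : Obj F) (G : ∀ E : Inv X, Inv (X.sub E) → ℂ) :
    ∑ E, ∑ U, G E U = ∑ U : Inv X, ∑ E : Inv X, if U.1 ≤ E.1 then G E (U.down E) else 0 := by
  rw [Finset.sum_comm]
  exact Finset.sum_congr rfl fun E _ => sum_sub X E _

theorem sum_chain_quo (X : Obj F) (G : ∀ U : Inv X, Inv (X.quo U) → ℂ) :
    ∑ U, ∑ E, G U E = ∑ U : Inv X, ∑ E : Inv X, if U.1 ≤ E.1 then G U (U.up E) else 0 :=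
  Finset.sum_congr rfl fun E _ => sum_quo X E _

theorem hm_assoc {f g h : Obj F → ℂ} (hf : IsCF f) (hg : IsCF g) (hh : IsCF h) :
    hm (hm f g) h = hm f (hm g h) := by
  funext X
  simp only [hm, Finset.sum_mul, Finset.mul_sum]
  refine (sum_chain_sub X _).trans (Eq.trans ?_ (sum_chain_quo X _).symm)
  refine Finset.sum_congr rfl fun U _ => Finset.sum_congr rfl fun E _ => ?_
  split_ifs with hUE
  · rw [hf _ _ (iso_sub_down U E hUE), hg _ _ (iso_quo_down U E), hh _ _ (iso_quo_up U E hUE),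
      mul_assoc]
  · rfl


/-! ### Coproduct -/

/-- The extension of `B` by `A` with cocycle `u`. -/
abbrev ext (A B : Obj F) (u : B.V →ₗ[F] A.V) : Obj F :=
  ⟨B.V × A.V, (B.T ∘ₗ LinearMap.fst F B.V A.V).prod
    (A.T ∘ₗ LinearMap.snd F B.V A.V + u ∘ₗ LinearMap.fst F B.V A.V)⟩

theorem ext_T (A B : Obj F) (u : B.V →ₗ[F] A.V) (v : B.V × A.V) :
    (ext A B u).T v = (B.T v.1, A.T v.2 + u v.1) := rfl

theorem dm_ext (A B : Obj F) (u : B.V →ₗ[F] A.V) : dm (ext A B u) = dm A + dm B := by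
  rw [add_comm]
  exact Module.finrank_prod

/-- The coproduct. -/
noncomputable def cop (f : Obj F → ℂ) (A B : Obj F) : ℂ :=
  (Fintype.card (B.V →ₗ[F] A.V) : ℂ)⁻¹ * ∑ u : B.V →ₗ[F] A.V, f (ext A B u)

theorem cop_iso {f : Obj F → ℂ} (hf : IsCF f) {A A' B B' : Obj F} (hA : Iso A A') (hB : Iso B B') :
    cop f A B = cop f A' B' := by
  obtain ⟨e, he⟩ := hA
  obtain ⟨d, hd⟩ := hB
  unfold cop
  rw [Fintype.card_congr (LinearEquiv.arrowCongr d e).toEquiv]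
  congr 1
  refine Fintype.sum_equiv (LinearEquiv.arrowCongr d e).toEquiv _ _ fun u => ?_
  apply hf
  refine ⟨d.prodCongr e, fun v => ?_⟩
  refine Prod.ext ?_ ?_
  · exact hd v.1
  · change e (A.T v.2 + u v.1) = A'.T (e v.2) + e (u (d.symm (d v.1)))
    rw [map_add, he, d.symm_apply_apply]

theorem cop_isCF {f : Obj F → ℂ} (hf : IsCF f) (A : Obj F) : IsCF (cop f A) :=
  fun _ _ h => cop_iso hf (Iso.rfl' A) h

theorem sum_surj {G H : Type} [AddCommGroup G] [AddCommGroup H] [Fintype G] [Fintype H]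
    (φ : G →+ H) (hφ : Function.Surjective φ) (k : H → ℂ) :
    (Fintype.card G : ℂ)⁻¹ * ∑ g, k (φ g) = (Fintype.card H : ℂ)⁻¹ * ∑ h, k h := by
  have hG : (Fintype.card G : ℂ) ≠ 0 := Nat.cast_ne_zero.2 Fintype.card_ne_zero
  have hH : (Fintype.card H : ℂ) ≠ 0 := Nat.cast_ne_zero.2 Fintype.card_ne_zero
  have h1 : ∀ h' : H, ∑ g, k (φ g + h') = ∑ g, k (φ g) := by
    intro h'
    obtain ⟨s, rfl⟩ := hφ h'
    refine Fintype.sum_equiv (Equiv.addRight s) _ _ fun g => ?_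
    simp
  have h2 : ∑ h' : H, ∑ g, k (φ g + h') = Fintype.card H * ∑ g, k (φ g) := by
    simp [h1]
  have h3 : ∑ h' : H, ∑ g, k (φ g + h') = Fintype.card G * ∑ h, k h := by
    rw [Finset.sum_comm]
    have : ∀ g, ∑ h', k (φ g + h') = ∑ h, k h := fun g =>
      Fintype.sum_equiv (Equiv.addLeft (φ g)) _ _ fun h => rfl
    simp [this]
  rw [h2] at h3
  field_simp
  linear_combination h3

/-- Primitive functions. -/
structure Prim (x : Obj F → ℂ) : Prop where
  cf : IsCF x
  zero : ∀ X, dm X = 0 → x X = 0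
  prim : ∀ A B : Obj F, dm A ≠ 0 → dm B ≠ 0 → cop x A B = 0

theorem sum_Inv (X : Obj F) (G : Inv X → ℂ) :
    ∑ W, G W = ∑ W : Submodule F X.V, if h : ∀ v ∈ W, X.T v ∈ W then G ⟨W, h⟩ else 0 := by
  refine Fintype.sum_of_injective Inv.W (fun _ _ h => Inv.ext h) _ _ ?_ ?_
  · intro W hW
    rw [dif_neg]
    intro h
    exact hW ⟨⟨W, h⟩, rfl⟩
  · intro W
    rw [dif_pos W.2]

theorem card_hom (A B : Obj F) (U : Submodule F B.V) :
    Fintype.card (U →ₗ[F] A.V) * Fintype.card ((B.V ⧸ U) →ₗ[F] A.V)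
      = Fintype.card (B.V →ₗ[F] A.V) := by
  rw [Module.card_eq_pow_finrank (K := F) (V := U →ₗ[F] A.V),
    Module.card_eq_pow_finrank (K := F) (V := (B.V ⧸ U) →ₗ[F] A.V),
    Module.card_eq_pow_finrank (K := F) (V := B.V →ₗ[F] A.V), ← pow_add]
  congr 1
  rw [Module.finrank_linearMap, Module.finrank_linearMap, Module.finrank_linearMap, ← add_mul,
    add_comm, Submodule.finrank_quotient_add_finrank]

/-- One term of the coproduct of a product. -/
noncomputable def tau (x f : Obj F → ℂ) (A B : Obj F) (W : Submodule F (B.V × A.V))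
    (u : B.V →ₗ[F] A.V) : ℂ :=
  if h : ∀ v ∈ W, (ext A B u).T v ∈ W then
    x ((ext A B u).sub ⟨W, h⟩) * f ((ext A B u).quo ⟨W, h⟩) else 0

theorem hm_ext (x f : Obj F → ℂ) (A B : Obj F) (u : B.V →ₗ[F] A.V) :
    hm x f (ext A B u) = ∑ W, tau x f A B W u := by
  unfold hm
  rw [sum_Inv]
  rfl

theorem tau_a {x f : Obj F → ℂ} (hx : IsCF x) (hf : IsCF f) (A B : Obj F) (U : Submodule F A.V) :
    ∑ u, tau x f A B (U.map (LinearMap.inr F B.V A.V)) u =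
      Fintype.card (B.V →ₗ[F] A.V) *
        if h : ∀ v ∈ U, A.T v ∈ U then x (A.sub ⟨U, h⟩) * cop f (A.quo ⟨U, h⟩) B else 0 := by
  have hC : (Fintype.card (B.V →ₗ[F] A.V) : ℂ) ≠ 0 := Nat.cast_ne_zero.2 Fintype.card_ne_zero
  split_ifs with h
  · have h1 : ∀ u, tau x f A B (U.map (LinearMap.inr F B.V A.V)) u =
        x (A.sub ⟨U, h⟩) * f (ext (A.quo ⟨U, h⟩) B (U.mkQ ∘ₗ u)) := by
      intro u
      have hst : ∀ v ∈ U.map (LinearMap.inr F B.V A.V), (ext A B u).T v ∈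
          U.map (LinearMap.inr F B.V A.V) := by
        rintro _ ⟨v, hv, rfl⟩
        refine ⟨A.T v, h v hv, ?_⟩
        refine Prod.ext ?_ ?_
        · change 0 = B.T 0
          simp
        · change A.T v = A.T v + u 0
          simp
      unfold tau
      rw [dif_pos hst]
      congr 1
      · symm
        apply hx
        refine iso_sub _ _ _ (LinearMap.inr F B.V A.V ∘ₗ U.subtype) ?_ ?_ ?_
        · exact LinearMap.inr_injective.comp Subtype.val_injective
        · intro v
          constructor
          · rintro ⟨a, ha, rfl⟩
            exact ⟨⟨a, ha⟩, rfl⟩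
          · rintro ⟨a, rfl⟩
            exact ⟨a.1, a.2, rfl⟩
        · intro v
          refine Prod.ext ?_ ?_
          · change 0 = B.T 0
            simp
          · change A.T v = A.T v + u 0
            simp
      · apply hf
        refine iso_quo _ _ _ (LinearMap.prodMap LinearMap.id U.mkQ) ?_ ?_ ?_
        · rintro ⟨b, a⟩
          obtain ⟨a, rfl⟩ := Submodule.mkQ_surjective _ a
          exact ⟨(b, a), rfl⟩
        · rintro ⟨b, a⟩
          refine Prod.ext_iff.trans ?_
          change b = 0 ∧ U.mkQ a = 0 ↔ _
          rw [Submodule.mkQ_apply, Submodule.Quotient.mk_eq_zero]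
          constructor
          · rintro ⟨rfl, ha⟩
            exact ⟨a, ha, rfl⟩
          · rintro ⟨a', ha', hh⟩
            have := Prod.ext_iff.1 hh
            have e2 : a' = a := this.2
            refine ⟨this.1.symm, ?_⟩
            rw [← e2]; exact ha'
        · rintro ⟨b, a⟩
          refine Prod.ext rfl ?_
          change U.mkQ (A.T a + u b) = U.mkQ (A.T a) + U.mkQ (u b)
          rw [map_add]
    simp only [h1]
    rw [← Finset.mul_sum]
    have := sum_surj (G := B.V →ₗ[F] A.V) (H := B.V →ₗ[F] (A.V ⧸ U))
      (LinearMap.toAddMonoidHom (LinearMap.compRight F U.mkQ)) (by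
        intro w
        obtain ⟨s, hs⟩ := LinearMap.exists_rightInverse_of_surjective U.mkQ
          (LinearMap.range_eq_top.2 (Submodule.mkQ_surjective _))
        refine ⟨s ∘ₗ w, ?_⟩
        ext b
        exact LinearMap.congr_fun hs (w b)) (fun u => f (ext (A.quo ⟨U, h⟩) B u))
    unfold cop
    have h4 : ∑ u : B.V →ₗ[F] A.V, f (ext (A.quo ⟨U, h⟩) B (U.mkQ ∘ₗ u)) =
      Fintype.card (B.V →ₗ[F] A.V) * ((Fintype.card (B.V →ₗ[F] (A.V ⧸ U)) : ℂ)⁻¹ *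
       ∑ u : B.V →ₗ[F] (A.V ⧸ U), f (ext (A.quo ⟨U, h⟩) B u)) := by
      rw [← this, mul_inv_cancel_left₀ hC]
      rfl
    rw [h4]
    ring
  · rw [mul_zero]
    refine Finset.sum_eq_zero fun u _ => ?_
    unfold tau
    rw [dif_neg]
    intro hst
    apply h
    intro v hv
    obtain ⟨w, hw, hh⟩ := hst (0, v) ⟨v, hv, rfl⟩
    have h2 : w = A.T v + u 0 := (Prod.ext_iff.1 hh).2
    rw [map_zero, add_zero] at h2
    rwa [← h2]

theorem tau_b {x f : Obj F → ℂ} (hx : IsCF x) (hf : IsCF f) (A B : Obj F) (U : Submodule F B.V)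
    (φ : U →ₗ[F] A.V) :
    ∑ u, tau x f A B (LinearPMap.graph ⟨U, φ⟩) u =
      if h : ∀ v ∈ U, B.T v ∈ U then x (B.sub ⟨U, h⟩) *
        ∑ u : (B.V ⧸ U) →ₗ[F] A.V, f (ext A (B.quo ⟨U, h⟩) u) else 0 := by
  have hgr : ∀ v : B.V × A.V, v ∈ (LinearPMap.graph ⟨U, φ⟩) ↔ ∃ h : v.1 ∈ U, v.2 = φ ⟨v.1, h⟩ := by
    intro v
    rw [LinearPMap.mem_graph_iff]
    constructor
    · rintro ⟨y, h1, h2⟩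
      have hy : v.1 ∈ U := by rw [← h1]; exact y.2
      refine ⟨hy, ?_⟩
      rw [← h2]
      change φ y = _
      congr 1
      exact Subtype.ext h1
    · rintro ⟨h, h'⟩
      exact ⟨⟨v.1, h⟩, rfl, h'.symm⟩
  split_ifs with h
  · obtain ⟨ψ, hψ⟩ := LinearMap.exists_extend φ
    have hψ' : ∀ b (hb : b ∈ U), ψ b = φ ⟨b, hb⟩ := fun b hb => LinearMap.congr_fun hψ ⟨b, hb⟩
    rw [Finset.mul_sum]
    symm
    refine Fintype.sum_of_injective
      (fun w : (B.V ⧸ U) →ₗ[F] A.V => (ψ ∘ₗ B.T - A.T ∘ₗ ψ) + w ∘ₗ U.mkQ) ?_ _ _ ?_ ?_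
    · intro w w' hw
      have := add_left_cancel hw
      ext b
      exact LinearMap.congr_fun this b
    · intro u hu
      unfold tau
      rw [dif_neg]
      intro hst
      apply hu
      refine ⟨U.liftQ (u - (ψ ∘ₗ B.T - A.T ∘ₗ ψ)) ?_, ?_⟩
      · intro b hb
        have h1 := (hgr _).1 (hst (b, φ ⟨b, hb⟩) ((hgr _).2 ⟨hb, rfl⟩))
        obtain ⟨h2, h3⟩ := h1
        have h4 : A.T (φ ⟨b, hb⟩) + u b = ψ (B.T b) := h3.trans (hψ' _ h2).symm
        rw [← hψ'] at h4
        simp only [LinearMap.mem_ker, LinearMap.sub_apply, LinearMap.comp_apply]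
        rw [← h4]
        abel
      · ext b
        simp
    · intro w
      have hst : ∀ v ∈ (LinearPMap.graph ⟨U, φ⟩),
          (ext A B ((ψ ∘ₗ B.T - A.T ∘ₗ ψ) + w ∘ₗ U.mkQ)).T v ∈ (LinearPMap.graph ⟨U, φ⟩) := by
        rintro ⟨b, a⟩ hv
        obtain ⟨hb, ha⟩ := (hgr _).1 hv
        refine (hgr _).2 ⟨h b hb, ?_⟩
        change A.T a + ((ψ (B.T b) - A.T (ψ b)) + w (U.mkQ b)) = φ ⟨B.T b, h b hb⟩
        have h0 : U.mkQ b = 0 := by simpa using hb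
        have ha' : a = φ ⟨b, hb⟩ := ha
        rw [h0, ha', ← hψ', ← hψ', map_zero]
        abel
      unfold tau
      rw [dif_pos hst]
      congr 1
      · apply hx
        refine iso_sub _ _ _ (U.subtype.prod φ) ?_ ?_ ?_
        · intro b b' hbb
          exact Subtype.ext (Prod.ext_iff.1 hbb).1
        · intro v
          refine (hgr v).trans ?_
          constructor
          · rintro ⟨h1, h2⟩
            exact ⟨⟨v.1, h1⟩, Prod.ext rfl h2.symm⟩
          · rintro ⟨u, rfl⟩
            exact ⟨u.2, rfl⟩
        · intro b
          refine Prod.ext rfl ?_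
          change φ ⟨B.T b.1, h b.1 b.2⟩ = A.T (φ b) +
            ((ψ (B.T b.1) - A.T (ψ b.1)) + w (U.mkQ b.1))
          have h0 : U.mkQ b.1 = 0 := by simp
          rw [h0, ← hψ', hψ' b.1 b.2, map_zero]
          abel
      · symm
        apply hf
        refine iso_quo _ _ _ ((U.mkQ ∘ₗ LinearMap.fst F _ _).prod
          (LinearMap.snd F _ _ - ψ ∘ₗ LinearMap.fst F _ _)) ?_ ?_ ?_
        · rintro ⟨b, a⟩
          obtain ⟨b, rfl⟩ := Submodule.mkQ_surjective _ b
          refine ⟨(b, a + ψ b), Prod.ext rfl ?_⟩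
          change a + ψ b - ψ b = a
          abel
        · rintro ⟨b, a⟩
          refine Prod.ext_iff.trans (Iff.trans ?_ (hgr _).symm)
          change U.mkQ b = 0 ∧ a - ψ b = 0 ↔ ∃ h : b ∈ U, a = φ ⟨b, h⟩
          rw [Submodule.mkQ_apply, Submodule.Quotient.mk_eq_zero, sub_eq_zero]
          constructor
          · rintro ⟨h1, h2⟩
            exact ⟨h1, h2.trans (hψ' _ _)⟩
          · rintro ⟨h1, h2⟩
            exact ⟨h1, h2.trans (hψ' _ _).symm⟩
        · rintro ⟨b, a⟩
          refine Prod.ext rfl ?_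
          change A.T a + ((ψ (B.T b) - A.T (ψ b)) + w (U.mkQ b)) - ψ (B.T b) =
            A.T (a - ψ b) + w (U.mkQ b)
          rw [map_sub]
          abel
  · refine Finset.sum_eq_zero fun u _ => ?_
    unfold tau
    rw [dif_neg]
    intro hst
    apply h
    intro v hv
    have := (hgr _).1 (hst (v, φ ⟨v, hv⟩) ((hgr _).2 ⟨hv, rfl⟩))
    exact this.1


theorem tau_c {x f : Obj F → ℂ} (hx : Prim x) (hf : IsCF f) (A B : Obj F)
    (W : Submodule F (B.V × A.V)) (h1 : ∃ w ∈ W, w.1 ≠ 0) (h2 : ∃ w ∈ W, w.1 = 0 ∧ w.2 ≠ 0) :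
    ∑ u, tau x f A B W u = 0 := by
  set W' : Submodule F A.V := W.comap (LinearMap.inr F B.V A.V) with hW'
  have hmem : ∀ a : W', ((0 : B.V), (a : A.V)) ∈ W := fun a => a.2
  set U : Submodule F B.V := W.map (LinearMap.fst F B.V A.V) with hUdef
  have key : ∀ u, ∑ v : B.V →ₗ[F] W', tau x f A B W (u + W'.subtype ∘ₗ v) = 0 := by
    intro u
    have hT : ∀ (v : B.V →ₗ[F] W') (w : B.V × A.V), (ext A B (u + W'.subtype ∘ₗ v)).T w =
        (ext A B u).T w + (0, (v w.1 : A.V)) := by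
      intro v w
      refine Prod.ext ?_ ?_
      · change B.T w.1 = B.T w.1 + 0
        simp
      · change A.T w.2 + (u w.1 + (v w.1 : A.V)) = A.T w.2 + u w.1 + (v w.1 : A.V)
        abel
    by_cases hst : ∀ w ∈ W, (ext A B u).T w ∈ W
    · have hst' : ∀ v : B.V →ₗ[F] W', ∀ w ∈ W, (ext A B (u + W'.subtype ∘ₗ v)).T w ∈ W := by
        intro v w hw
        rw [hT]
        exact W.add_mem (hst w hw) (hmem _)
      have hsA : ∀ a ∈ W', A.T a ∈ W' := by
        intro a ha
        have := hst (0, a) ha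
        rw [ext_T] at this
        simpa [hW'] using this
      have hsB : ∀ b ∈ U, B.T b ∈ U := by
        rintro _ ⟨w, hw, rfl⟩
        exact ⟨_, hst w hw, rfl⟩
      let A0 : Obj F := A.sub ⟨W', hsA⟩
      let B0 : Obj F := B.sub ⟨U, hsB⟩
      have hA0 : dm A0 ≠ 0 := by
        obtain ⟨w, hw, hw1, hw2⟩ := h2
        have hww : w.2 ∈ W' := by
          change (0, w.2) ∈ W
          rw [← hw1]
          exact hw
        have : Nontrivial W' := ⟨⟨w.2, hww⟩, 0, fun h => hw2 (congrArg Subtype.val h)⟩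
        exact (Module.finrank_pos (R := F) (M := W')).ne'
      have hB0 : dm B0 ≠ 0 := by
        obtain ⟨w, hw, hw1⟩ := h1
        have : Nontrivial U := ⟨⟨w.1, ⟨w, hw, rfl⟩⟩, 0, fun h => hw1 (congrArg Subtype.val h)⟩
        exact (Module.finrank_pos (R := F) (M := U)).ne'
      let p : W →ₗ[F] U := LinearMap.codRestrict U (LinearMap.fst F B.V A.V ∘ₗ W.subtype)
        fun w => ⟨w.1, w.2, rfl⟩
      obtain ⟨s, hs⟩ := LinearMap.exists_rightInverse_of_surjective p
        (LinearMap.range_eq_top.2 (by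
          rintro ⟨_, w, hw, rfl⟩
          exact ⟨⟨w, hw⟩, rfl⟩))
      have hs1 : ∀ b : U, (s b).1.1 = b.1 := fun b =>
        congrArg Subtype.val (LinearMap.congr_fun hs b)
      let σ : U →ₗ[F] A.V := LinearMap.snd F B.V A.V ∘ₗ W.subtype ∘ₗ s
      have hσ : ∀ b : U, (b.1, σ b) ∈ W := by
        intro b
        have : (b.1, σ b) = (s b).1 := Prod.ext (hs1 b).symm rfl
        rw [this]
        exact (s b).2
      let u0 : U →ₗ[F] W' := LinearMap.codRestrict W' (A.T ∘ₗ σ + u ∘ₗ U.subtype - σ ∘ₗ B0.T) (by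
        intro b
        have h3 := W.sub_mem (hst _ (hσ b)) (hσ (B0.T b))
        have : (ext A B u).T (b.1, σ b) - ((B0.T b).1, σ (B0.T b)) =
          (0, (A.T ∘ₗ σ + u ∘ₗ U.subtype - σ ∘ₗ B0.T) b) := by
          refine Prod.ext ?_ ?_
          · change B.T b.1 - B.T b.1 = 0
            simp
          · rfl
        rw [this] at h3
        exact h3)
      have hiso : ∀ v : B.V →ₗ[F] W', Iso (ext A0 B0 (u0 + v ∘ₗ U.subtype))
          ((ext A B (u + W'.subtype ∘ₗ v)).sub ⟨W, hst' v⟩) := by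
        intro v
        refine iso_sub _ _ _ ((U.subtype ∘ₗ LinearMap.fst F U W').prod
          (σ ∘ₗ LinearMap.fst F U W' + W'.subtype ∘ₗ LinearMap.snd F U W')) ?_ ?_ ?_
        · rintro ⟨b, a⟩ ⟨b', a'⟩ hh
          have e1 : b = b' := Subtype.ext (Prod.ext_iff.1 hh).1
          subst e1
          have e2 : σ b + a.1 = σ b + a'.1 := (Prod.ext_iff.1 hh).2
          exact Prod.ext rfl (Subtype.ext (add_left_cancel e2))
        · intro w
          constructor
          · intro hw
            have hb : w.1 ∈ U := ⟨w, hw, rfl⟩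
            have h4 := W.sub_mem hw (hσ ⟨w.1, hb⟩)
            have h5 : w - (w.1, σ ⟨w.1, hb⟩) = (0, w.2 - σ ⟨w.1, hb⟩) :=
              Prod.ext (sub_self _) rfl
            have ha : w.2 - σ ⟨w.1, hb⟩ ∈ W' := by
              change (0, w.2 - σ ⟨w.1, hb⟩) ∈ W
              rw [← h5]
              exact h4
            refine ⟨(⟨w.1, hb⟩, ⟨_, ha⟩), Prod.ext rfl ?_⟩
            change σ ⟨w.1, hb⟩ + (w.2 - σ ⟨w.1, hb⟩) = w.2
            abel
          · rintro ⟨⟨b, a⟩, rfl⟩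
            have h6 := W.add_mem (hσ b) (hmem a)
            have h7 : (b.1, σ b) + ((0 : B.V), (a : A.V)) = (b.1, σ b + a.1) :=
              Prod.ext (add_zero _) rfl
            rw [h7] at h6
            exact h6
        · rintro ⟨b, a⟩
          refine Prod.ext rfl ?_
          change σ (B0.T b) + (A.T a.1 + ((A.T (σ b) + u b.1 - σ (B0.T b)) + (v b.1 : A.V))) =
            A.T (σ b + a.1) + (u b.1 + (v b.1 : A.V))
          rw [map_add]
          abel
      have hq : ∀ v : B.V →ₗ[F] W', Iso ((ext A B (u + W'.subtype ∘ₗ v)).quo ⟨W, hst' v⟩)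
          ((ext A B u).quo ⟨W, hst⟩) := by
        intro v
        refine iso_quo _ _ _ W.mkQ (Submodule.mkQ_surjective _) ?_ ?_
        · intro w
          exact Submodule.Quotient.mk_eq_zero _
        · intro w
          change W.mkQ _ = W.mkQ ((ext A B u).T w)
          rw [hT, map_add]
          have : W.mkQ (0, (v w.1 : A.V)) = 0 := (Submodule.Quotient.mk_eq_zero _).2 (hmem _)
          rw [this, add_zero]
      have hterm : ∀ v : B.V →ₗ[F] W', tau x f A B W (u + W'.subtype ∘ₗ v) =
          x (ext A0 B0 (u0 + v ∘ₗ U.subtype)) * f ((ext A B u).quo ⟨W, hst⟩) := by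
        intro v
        unfold tau
        rw [dif_pos (hst' v), hx.cf _ _ (hiso v), hf _ _ (hq v)]
      simp only [hterm]
      rw [← Finset.sum_mul]
      have h8 := sum_surj (G := B.V →ₗ[F] W') (H := U →ₗ[F] W')
        (LinearMap.toAddMonoidHom (LinearMap.lcomp F W' U.subtype)) (by
          intro w
          obtain ⟨g, hg⟩ := LinearMap.exists_extend w
          exact ⟨g, hg⟩) (fun v => x (ext A0 B0 (u0 + v)))
      have h9 : ∑ v : U →ₗ[F] W', x (ext A0 B0 (u0 + v)) = ∑ v : U →ₗ[F] W', x (ext A0 B0 v) :=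
        Fintype.sum_equiv (Equiv.addLeft u0) _ _ fun _ => rfl
      have h10 : (Fintype.card (U →ₗ[F] W') : ℂ)⁻¹ * ∑ v : U →ₗ[F] W', x (ext A0 B0 v) = 0 :=
        hx.prim A0 B0 hA0 hB0
      rw [h9, h10] at h8
      have h11 : ∑ v : B.V →ₗ[F] W', x (ext A0 B0 (u0 + v ∘ₗ U.subtype)) = 0 := by
        rcases mul_eq_zero.1 h8 with h | h
        · exact absurd h (inv_ne_zero (Nat.cast_ne_zero.2 Fintype.card_ne_zero))
        · exact h
      rw [h11, zero_mul]
    · refine Finset.sum_eq_zero fun v _ => ?_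
      unfold tau
      rw [dif_neg]
      intro h
      apply hst
      intro w hw
      have h3 := W.sub_mem (h w hw) (hmem (v w.1))
      rw [hT, add_sub_cancel_right] at h3
      exact h3
  have h3 : ∑ v : B.V →ₗ[F] W', ∑ u, tau x f A B W (u + W'.subtype ∘ₗ v) = 0 := by
    rw [Finset.sum_comm]
    exact Finset.sum_eq_zero fun u _ => key u
  have h4 : ∀ v : B.V →ₗ[F] W', ∑ u, tau x f A B W (u + W'.subtype ∘ₗ v) =
      ∑ u, tau x f A B W u := fun v =>
    Fintype.sum_equiv (Equiv.addRight (W'.subtype ∘ₗ v)) _ _ fun _ => rfl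
  simp only [h4, Finset.sum_const, nsmul_eq_mul] at h3
  rcases mul_eq_zero.1 h3 with h | h
  · refine absurd h (Nat.cast_ne_zero.2 ?_)
    rw [Finset.card_univ]
    exact Fintype.card_ne_zero
  · exact h

/-- The coproduct of a product with a primitive function. -/
theorem cop_hm {x f : Obj F → ℂ} (hx : Prim x) (hf : IsCF f) (A B : Obj F) :
    cop (hm x f) A B = ∑ U : Inv A, x (A.sub U) * cop f (A.quo U) B +
      ∑ U : Inv B, x (B.sub U) * cop f A (B.quo U) := by
  have hC : (Fintype.card (B.V →ₗ[F] A.V) : ℂ) ≠ 0 := Nat.cast_ne_zero.2 Fintype.card_ne_zero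
  unfold cop
  simp only [hm_ext]
  rw [inv_mul_eq_iff_eq_mul₀ hC, Finset.sum_comm]
  change _ = _ * (∑ U : Inv A, x (A.sub U) * cop f (A.quo U) B +
      ∑ U : Inv B, x (B.sub U) * cop f A (B.quo U))
  have hsplit : ∀ W : Submodule F (B.V × A.V), ∑ u, tau x f A B W u =
      (if ∀ w ∈ W, w.1 = 0 then ∑ u, tau x f A B W u else 0) +
      (if ∀ w ∈ W, w.1 = 0 → w.2 = 0 then ∑ u, tau x f A B W u else 0) := by
    intro W
    by_cases h1 : ∀ w ∈ W, w.1 = 0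
    · by_cases h2 : ∀ w ∈ W, w.1 = 0 → w.2 = 0
      · have h3 : ∑ u, tau x f A B W u = 0 := by
          refine Finset.sum_eq_zero fun u _ => ?_
          unfold tau
          split_ifs with h
          · rw [hx.zero, zero_mul]
            change Module.finrank F W = 0
            have : W = ⊥ := by
              rw [eq_bot_iff]
              intro w hw
              exact Prod.ext (h1 w hw) (h2 w hw (h1 w hw))
            rw [this]
            exact finrank_bot _ _
          · rfl
        simp [h3]
      · rw [if_pos h1, if_neg h2, add_zero]
    · by_cases h2 : ∀ w ∈ W, w.1 = 0 → w.2 = 0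
      · rw [if_neg h1, if_pos h2, zero_add]
      · rw [if_neg h1, if_neg h2, add_zero]
        push Not at h1 h2
        exact tau_c hx hf A B W h1 h2
  rw [Finset.sum_congr rfl fun W _ => hsplit W, Finset.sum_add_distrib, mul_add]
  congr 1
  · rw [← Finset.sum_filter, sum_Inv, Finset.mul_sum,
      Finset.sum_congr rfl fun U _ => (tau_a hx.cf hf A B U).symm]
    symm
    refine Finset.sum_bij (fun U _ => U.map (LinearMap.inr F B.V A.V)) ?_ ?_ ?_ (fun _ _ => rfl)
    · intro U _
      refine Finset.mem_filter.2 ⟨Finset.mem_univ _, ?_⟩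
      rintro _ ⟨a, _, rfl⟩
      rfl
    · intro U _ U' _ h
      exact Submodule.map_injective_of_injective LinearMap.inr_injective h
    · intro W hW
      have hW := (Finset.mem_filter.1 hW).2
      refine ⟨W.comap (LinearMap.inr F B.V A.V), Finset.mem_univ _, ?_⟩
      rw [Submodule.map_comap_eq, inf_eq_right]
      intro w hw
      exact ⟨w.2, Prod.ext (hW w hw).symm rfl⟩
  · rw [sum_Inv, Finset.mul_sum]
    have h1 : ∀ U : Submodule F B.V, (Fintype.card (B.V →ₗ[F] A.V) : ℂ) *
        (if h : ∀ v ∈ U, B.T v ∈ U then x (B.sub ⟨U, h⟩) * cop f A (B.quo ⟨U, h⟩) else 0) =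
        ∑ φ : U →ₗ[F] A.V, ∑ u, tau x f A B (LinearPMap.graph ⟨U, φ⟩) u := by
      intro U
      rw [Finset.sum_congr rfl fun φ _ => tau_b hx.cf hf A B U φ, Finset.sum_const, nsmul_eq_mul,
        Finset.card_univ]
      split_ifs with h
      · have h2 : (Fintype.card ((B.V ⧸ U) →ₗ[F] A.V) : ℂ) ≠ 0 :=
          Nat.cast_ne_zero.2 Fintype.card_ne_zero
        rw [← card_hom A B U]
        unfold cop
        push_cast
        field_simp
      · simp
    rw [Finset.sum_congr rfl fun U _ => h1 U, ← Finset.sum_filter]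
    symm
    refine (Finset.sum_sigma' _ _ _).trans ?_
    refine Finset.sum_bij (fun p _ => LinearPMap.graph ⟨p.1, p.2⟩) ?_ ?_ ?_ (fun _ _ => rfl)
    · intro p _
      refine Finset.mem_filter.2 ⟨Finset.mem_univ _, ?_⟩
      intro w hw h
      exact LinearPMap.graph_fst_eq_zero_snd _ hw h
    · rintro ⟨U, φ⟩ _ ⟨U', φ'⟩ _ h
      have := LinearPMap.eq_of_eq_graph h
      cases this
      rfl
    · intro W hW
      have hW := (Finset.mem_filter.1 hW).2
      exact ⟨⟨W.toLinearPMap.domain, W.toLinearPMap.toFun⟩, by simp,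
        Submodule.toLinearPMap_graph_eq W hW⟩


/-! ### Antipode -/

/-- The iterated coproduct followed by the iterated product along a list. -/
noncomputable def Rc : List ℕ → (Obj F → ℂ) → Obj F → ℂ
  | [], f => fun X => if dm X = 0 then f X else 0
  | k :: L, f => fun X => ∑ W : Inv X,
      if dm (X.sub W) = k then Rc L (cop f (X.sub W)) (X.quo W) else 0

theorem Rc_isCF (L : List ℕ) : ∀ {f : Obj F → ℂ}, IsCF f → IsCF (Rc L f) := by
  induction L with
  | nil =>
    intro f hf X Y h
    simp only [Rc, h.dm_eq, hf _ _ h]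
  | cons k L ih =>
    intro f hf X Y h
    refine h.sum_inv (fun A B => if dm A = k then Rc L (cop f A) B else 0) ?_ ?_
    · intro A A' B hA
      have : cop f A = cop f A' := funext fun B => cop_iso hf hA (Iso.rfl' B)
      simp only [hA.dm_eq, this]
    · intro A B B' hB
      have := ih (cop_isCF hf A) B B' hB
      simp only [this]

theorem cop_add (f g : Obj F → ℂ) (A : Obj F) : cop (f + g) A = cop f A + cop g A := by
  funext B
  simp only [cop, Pi.add_apply, Finset.sum_add_distrib, mul_add]

theorem cop_smul (a : ℂ) (f : Obj F → ℂ) (A : Obj F) : cop (a • f) A = a • cop f A := by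
  funext B
  simp only [cop, Pi.smul_apply, smul_eq_mul, ← Finset.mul_sum]
  ring

theorem Rc_add (L : List ℕ) : ∀ (f g : Obj F → ℂ), Rc L (f + g) = Rc L f + Rc L g := by
  induction L with
  | nil =>
    intro f g; funext X
    simp only [Rc, Pi.add_apply]
    split_ifs <;> simp
  | cons k L ih =>
    intro f g; funext X
    simp only [Rc, Pi.add_apply, ← Finset.sum_add_distrib, cop_add, ih]
    refine Finset.sum_congr rfl fun W _ => ?_
    split_ifs <;> simp

theorem Rc_smul (L : List ℕ) : ∀ (a : ℂ) (f : Obj F → ℂ), Rc L (a • f) = a • Rc L f := by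
  induction L with
  | nil =>
    intro f g; funext X
    simp only [Rc, Pi.smul_apply]
    split_ifs <;> simp
  | cons k L ih =>
    intro f g; funext X
    simp only [Rc, Pi.smul_apply, Finset.smul_sum, cop_smul, ih]
    refine Finset.sum_congr rfl fun W _ => ?_
    split_ifs <;> simp

/-- The antipode, in degree `n`. -/
noncomputable def Sd (n : ℕ) (f : Obj F → ℂ) (X : Obj F) : ℂ :=
  ∑ c : Composition n, (-1) ^ c.length * Rc c.blocks f X

/-- The antipode. -/
noncomputable def S (f : Obj F → ℂ) (X : Obj F) : ℂ := Sd (dm X) f X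

theorem S_isCF {f : Obj F → ℂ} (hf : IsCF f) : IsCF (S f) := by
  intro X Y h
  unfold S
  rw [h.dm_eq]
  simp only [Sd, Rc_isCF _ hf X Y h]

theorem S_add (f g : Obj F → ℂ) : S (f + g) = S f + S g := by
  funext X
  simp only [S, Sd, Rc_add, Pi.add_apply, mul_add, Finset.sum_add_distrib]

theorem S_smul (a : ℂ) (f : Obj F → ℂ) : S (a • f) = a • S f := by
  funext X
  simp only [S, Sd, Rc_smul, Pi.smul_apply, smul_eq_mul, Finset.mul_sum]
  exact Finset.sum_congr rfl fun _ _ => by ring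

theorem S_zero : S (0 : Obj F → ℂ) = 0 := by
  have := S_smul (F := F) 0 0
  simpa using this

theorem S_sum {ι : Type} (s : Finset ι) (f : ι → Obj F → ℂ) :
    S (∑ i ∈ s, f i) = ∑ i ∈ s, S (f i) := by
  induction s using Finset.induction_on with
  | empty => simp [S_zero]
  | insert a s ha ih => rw [Finset.sum_insert ha, Finset.sum_insert ha, S_add, ih]

/-- Prepend a block. -/
def consComp (n : ℕ) (k : Fin (n + 1)) (c : Composition (n - k)) : Composition (n + 1) :=
  ⟨(k + 1) :: c.blocks, by
    intro i hi
    rcases List.mem_cons.1 hi with h | h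
    · omega
    · exact c.blocks_pos h, by
    rw [List.sum_cons, c.blocks_sum]
    omega⟩

theorem sum_comp_succ (n : ℕ) (G : List ℕ → ℂ) :
    ∑ c : Composition (n + 1), G c.blocks =
      ∑ k : Fin (n + 1), ∑ c : Composition (n - k), G ((k + 1) :: c.blocks) := by
  symm
  refine (Finset.sum_sigma' _ _ _).trans ?_
  refine Finset.sum_bij (fun p _ => consComp n p.1 p.2) (fun _ _ => Finset.mem_univ _) ?_ ?_
    (fun _ _ => rfl)
  · rintro ⟨k, c⟩ _ ⟨k', c'⟩ _ h
    have h1 : (k + 1 : ℕ) :: c.blocks = (k' + 1 : ℕ) :: c'.blocks :=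
      congrArg Composition.blocks h
    obtain ⟨h2, h3⟩ := List.cons.inj h1
    have h4 : k = k' := Fin.ext (by omega)
    subst h4
    have h5 : c = c' := Composition.ext h3
    rw [h5]
  · intro c _
    obtain ⟨bl, hp, hs⟩ := c
    cases bl with
    | nil => simp at hs
    | cons a L =>
      have ha : 0 < a := hp (by simp)
      have hsum : a + L.sum = n + 1 := by simpa using hs
      refine ⟨⟨⟨a - 1, by omega⟩, ⟨L, fun {i} hi => hp (by simp [hi]), ?_⟩⟩, Finset.mem_univ _, ?_⟩
      · change L.sum = n - (a - 1)
        omega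
      · apply Composition.ext
        change (a - 1 + 1) :: L = a :: L
        rw [Nat.sub_add_cancel ha]

theorem S_dm_zero (f : Obj F → ℂ) (X : Obj F) (h : dm X = 0) : S f X = f X := by
  unfold S
  rw [h]
  unfold Sd
  have hbl : ∀ c : Composition 0, c.blocks = [] := by
    intro c
    have := c.blocks_sum
    by_contra hne
    obtain ⟨a, L, hL⟩ := List.exists_cons_of_ne_nil hne
    have h1 : 0 < a := c.blocks_pos (by rw [hL]; simp)
    rw [hL] at this
    simp at this
    omega
  rw [Fintype.sum_eq_single (⟨[], by simp, by simp⟩ : Composition 0)]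
  · simp [Composition.length, Rc, h]
  · intro c hc
    exact absurd (Composition.ext (hbl c)) hc

theorem S_rec (f : Obj F → ℂ) (X : Obj F) (h : dm X ≠ 0) :
    S f X = - ∑ W : Inv X, if dm (X.sub W) = 0 then 0 else S (cop f (X.sub W)) (X.quo W) := by
  obtain ⟨n, hn⟩ := Nat.exists_eq_succ_of_ne_zero h
  unfold S
  rw [hn]
  have e1 : Sd (n + 1) f X = ∑ k : Fin (n + 1), ∑ c : Composition (n - k),
      ∑ W : Inv X, (-1) ^ (c.length + 1) *
        (if dm (X.sub W) = k + 1 then Rc c.blocks (cop f (X.sub W)) (X.quo W) else 0) := by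
    unfold Sd
    refine (sum_comp_succ n (fun b => (-1) ^ b.length * Rc b f X)).trans ?_
    refine Finset.sum_congr rfl fun k _ => Finset.sum_congr rfl fun c _ => ?_
    simp only [Rc, List.length_cons, Composition.blocks_length, Finset.mul_sum]
  rw [Nat.succ_eq_add_one, e1]
  rw [Finset.sum_congr rfl fun k _ => Finset.sum_comm, Finset.sum_comm, ← Finset.sum_neg_distrib]
  refine Finset.sum_congr rfl fun W _ => ?_
  have hW := dm_quo X W
  split_ifs with h0
  · simp [h0]
  · rw [Finset.sum_eq_single (⟨dm (X.sub W) - 1, by omega⟩ : Fin (n + 1))]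
    · have e : n - (dm (X.sub W) - 1) = dm (X.quo W) := by omega
      change ∑ c : Composition (n - (dm (X.sub W) - 1)), _ = _
      rw [e]
      unfold Sd
      rw [← Finset.sum_neg_distrib]
      refine Finset.sum_congr rfl fun c _ => ?_
      rw [if_pos (by change _ = dm (X.sub W) - 1 + 1; omega), pow_succ]
      ring
    · intro k _ hk
      refine Finset.sum_eq_zero fun c _ => ?_
      rw [if_neg, mul_zero]
      intro h'
      exact hk (Fin.ext (by change _ = dm (X.sub W) - 1; omega))
    · intro h; exact absurd (Finset.mem_univ _) h

/-! ### Zero and full subspaces -/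

/-- The zero subobject. -/
def botI (X : Obj F) : Inv X := ⟨⊥, by
  intro v hv
  rw [(Submodule.mem_bot F).1 hv, map_zero]
  exact Submodule.zero_mem _⟩

/-- The full subobject. -/
def topI (X : Obj F) : Inv X := ⟨⊤, fun _ _ => Submodule.mem_top⟩

theorem dm_sub_zero (X : Obj F) (W : Inv X) : dm (X.sub W) = 0 ↔ W = botI X := by
  rw [dm_sub, Submodule.finrank_eq_zero]
  exact ⟨fun h => Inv.ext h, fun h => by rw [h]; rfl⟩

theorem dm_quo_zero (X : Obj F) (W : Inv X) : dm (X.quo W) = 0 ↔ W = topI X := by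
  have := dm_quo X W
  constructor
  · intro h
    apply Inv.ext
    change W.W = ⊤
    apply Submodule.eq_top_of_finrank_eq
    have h2 := dm_sub X W
    unfold dm at *
    omega
  · rintro rfl
    have h2 : dm (X.sub (topI X)) = dm X := finrank_top F X.V
    omega

theorem iso_quo_bot (X : Obj F) : Iso (X.quo (botI X)) X :=
  iso_quo _ _ _ LinearMap.id Function.surjective_id
    (fun v => ((Submodule.mem_bot F).symm : v = 0 ↔ _)) fun _ => rfl

theorem iso_sub_top (X : Obj F) : Iso X (X.sub (topI X)) :=
  iso_sub _ _ _ LinearMap.id Function.injective_id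
    (fun v => ⟨fun _ => ⟨v, rfl⟩, fun _ => Submodule.mem_top⟩) fun _ => rfl

theorem dm_zero_sub {X : Obj F} (h : dm X = 0) (v : X.V) : v = 0 := by
  have : Subsingleton X.V := Module.finrank_zero_iff.1 h
  exact Subsingleton.elim _ _

theorem iso_zero {X Y : Obj F} (hX : dm X = 0) (hY : dm Y = 0) : Iso X Y := by
  have : Subsingleton X.V := Module.finrank_zero_iff.1 hX
  have : Subsingleton Y.V := Module.finrank_zero_iff.1 hY
  exact ⟨LinearEquiv.ofSubsingleton _ _, fun v => Subsingleton.elim _ _⟩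

theorem cop_zero_left {f : Obj F → ℂ} (hf : IsCF f) {A : Obj F} (hA : dm A = 0) (B : Obj F) :
    cop f A B = f B := by
  have : Subsingleton A.V := Module.finrank_zero_iff.1 hA
  have hu : ∀ u : B.V →ₗ[F] A.V, f (ext A B u) = f B := by
    intro u
    apply hf
    refine ⟨LinearEquiv.ofBijective (LinearMap.fst F B.V A.V) ⟨?_, LinearMap.fst_surjective⟩, ?_⟩
    · intro v w h
      exact Prod.ext h (Subsingleton.elim _ _)
    · intro v; rfl
  have hC : (Fintype.card (B.V →ₗ[F] A.V) : ℂ) ≠ 0 :=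
    Nat.cast_ne_zero.2 Fintype.card_ne_zero
  simp only [cop, hu, Finset.sum_const, Finset.card_univ, nsmul_eq_mul]
  field_simp

theorem cop_zero_right {f : Obj F → ℂ} (hf : IsCF f) (A : Obj F) {B : Obj F} (hB : dm B = 0) :
    cop f A B = f A := by
  have : Subsingleton B.V := Module.finrank_zero_iff.1 hB
  have hu : ∀ u : B.V →ₗ[F] A.V, f (ext A B u) = f A := by
    intro u
    apply hf
    refine ⟨LinearEquiv.ofBijective (LinearMap.snd F B.V A.V) ⟨?_, LinearMap.snd_surjective⟩, ?_⟩
    · intro v w h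
      exact Prod.ext (Subsingleton.elim _ _) h
    · intro v
      change A.T v.2 + u v.1 = A.T v.2
      rw [Subsingleton.elim v.1 0, map_zero, add_zero]
  have hC : (Fintype.card (B.V →ₗ[F] A.V) : ℂ) ≠ 0 :=
    Nat.cast_ne_zero.2 Fintype.card_ne_zero
  simp only [cop, hu, Finset.sum_const, Finset.card_univ, nsmul_eq_mul]
  field_simp

theorem S_sum_all {f : Obj F → ℂ} (hf : IsCF f) (X : Obj F) :
    ∑ W : Inv X, S (cop f (X.sub W)) (X.quo W) = if dm X = 0 then f X else 0 := by
  have h0 : dm (X.sub (botI X)) = 0 := (dm_sub_zero X _).2 rfl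
  have e0 : S (cop f (X.sub (botI X))) (X.quo (botI X)) = S f X := by
    have : cop f (X.sub (botI X)) = f := funext fun B => cop_zero_left hf h0 B
    rw [this]
    exact S_isCF hf _ _ (iso_quo_bot X)
  split_ifs with h
  · rw [Fintype.sum_eq_single (botI X), e0, S_dm_zero f X h]
    intro W hW
    exact absurd ((dm_sub_zero X W).1 (by have := dm_quo X W; omega)) hW
  · have h1 := S_rec f X h
    rw [← Finset.add_sum_erase _ _ (Finset.mem_univ (botI X))] at h1 ⊢
    rw [e0, h1, if_pos h0, zero_add]
    rw [neg_add_eq_zero]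
    refine Finset.sum_congr rfl fun W hW => ?_
    rw [if_neg]
    rw [dm_sub_zero]
    exact (Finset.mem_erase.1 hW).1

theorem S_hm {x : Obj F → ℂ} (hx : Prim x) : ∀ (n : ℕ) {f : Obj F → ℂ}, IsCF f →
    ∀ X : Obj F, dm X = n → S (hm x f) X = - hm (S f) x X := by
  intro n
  induction n using Nat.strong_induction_on with
  | _ n ih =>
  intro f hf X hX
  by_cases h0 : dm X = 0
  · rw [S_dm_zero _ X h0]
    unfold hm
    rw [Finset.sum_eq_zero, Finset.sum_eq_zero, neg_zero]
    · intro W _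
      rw [hx.zero (X.quo W) (by have := dm_quo X W; omega), mul_zero]
    · intro W _
      rw [hx.zero (X.sub W) (by have := dm_quo X W; omega), zero_mul]
  rw [S_rec _ X h0]
  have hb : dm (X.sub (botI X)) = 0 := (dm_sub_zero X _).2 rfl
  have ht : dm (X.quo (topI X)) = 0 := (dm_quo_zero X _).2 rfl
  -- expand the coproduct
  have e1 : ∀ W : Inv X, (if dm (X.sub W) = 0 then 0 else S (cop (hm x f) (X.sub W)) (X.quo W)) =
      (∑ U : Inv (X.sub W), x ((X.sub W).sub U) * S (cop f ((X.sub W).quo U)) (X.quo W)) -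
      (if dm (X.sub W) = 0 then 0 else hm (S (cop f (X.sub W))) x (X.quo W)) := by
    intro W
    split_ifs with hW
    · rw [Finset.sum_eq_zero, sub_zero]
      intro U _
      rw [hx.zero ((X.sub W).sub U) (by have := dm_quo (X.sub W) U; omega), zero_mul]
    · have e2 : cop (hm x f) (X.sub W) =
          (∑ U : Inv (X.sub W), x ((X.sub W).sub U) • cop f ((X.sub W).quo U)) +
            hm x (cop f (X.sub W)) := by
        funext B
        rw [cop_hm hx hf]
        simp only [Pi.add_apply, Finset.sum_apply, Pi.smul_apply, smul_eq_mul, hm]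
      rw [e2, S_add, S_sum, Pi.add_apply,
        ih (dm (X.quo W)) (by have := dm_quo X W; omega) (cop_isCF hf _) _ rfl, sub_eq_add_neg]
      simp only [S_smul, Finset.sum_apply, Pi.smul_apply, smul_eq_mul]
  rw [Finset.sum_congr rfl fun W _ => e1 W, Finset.sum_sub_distrib]
  have t1 : ∑ W : Inv X, ∑ U : Inv (X.sub W),
      x ((X.sub W).sub U) * S (cop f ((X.sub W).quo U)) (X.quo W) =
      x X * f (X.quo (topI X)) := by
    refine (sum_chain_sub X _).trans ?_
    have e3 : ∀ U E : Inv X, (if U.1 ≤ E.1 then x ((X.sub E).sub (U.down E)) *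
        S (cop f ((X.sub E).quo (U.down E))) (X.quo E) else 0) =
        if U.1 ≤ E.1 then (fun (U : Inv X) (E : Inv (X.quo U)) => x (X.sub U) *
          S (cop f ((X.quo U).sub E)) ((X.quo U).quo E)) U (U.up E) else 0 := by
      intro U E
      split_ifs with hUE
      · have i1 := iso_sub_down U E hUE
        have i2 := iso_quo_down U E
        have i3 := iso_quo_up U E hUE
        have e : cop f ((X.sub E).quo (U.down E)) = cop f ((X.quo U).sub (U.up E)) :=
          funext fun B => cop_iso hf i2 (Iso.rfl' B)
        rw [hx.cf _ _ i1, e, S_isCF (cop_isCF hf _) _ _ i3]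
      · rfl
    rw [Finset.sum_congr rfl fun U _ => Finset.sum_congr rfl fun E _ => e3 U E]
    refine (sum_chain_quo X (fun (U : Inv X) (E : Inv (X.quo U)) => x (X.sub U) *
          S (cop f ((X.quo U).sub E)) ((X.quo U).quo E))).symm.trans ?_
    simp only [← Finset.mul_sum, S_sum_all hf]
    rw [Fintype.sum_eq_single (topI X)]
    · rw [if_pos ht, ← hx.cf _ _ (iso_sub_top X)]
    · intro U hU
      rw [if_neg, mul_zero]
      rwa [dm_quo_zero]
  have t2 : ∑ W : Inv X, hm (S (cop f (X.sub W))) x (X.quo W) =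
      f (X.sub (botI X)) * x X := by
    unfold hm
    refine (sum_chain_quo X _).trans ?_
    have e3 : ∀ U E : Inv X, (if U.1 ≤ E.1 then S (cop f (X.sub U)) ((X.quo U).sub (U.up E)) *
        x ((X.quo U).quo (U.up E)) else 0) =
        if U.1 ≤ E.1 then (fun (E : Inv X) (U : Inv (X.sub E)) =>
          S (cop f ((X.sub E).sub U)) ((X.sub E).quo U) * x (X.quo E)) E (U.down E) else 0 := by
      intro U E
      split_ifs with hUE
      · have i1 := iso_sub_down U E hUE
        have i2 := iso_quo_down U E
        have i3 := iso_quo_up U E hUE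
        have e : cop f ((X.sub E).sub (U.down E)) = cop f (X.sub U) :=
          funext fun B => cop_iso hf i1 (Iso.rfl' B)
        simp only
        rw [hx.cf _ _ i3, e, S_isCF (cop_isCF hf _) _ _ i2]
      · rfl
    rw [Finset.sum_congr rfl fun U _ => Finset.sum_congr rfl fun E _ => e3 U E]
    refine (sum_chain_sub X (fun (E : Inv X) (U : Inv (X.sub E)) =>
          S (cop f ((X.sub E).sub U)) ((X.sub E).quo U) * x (X.quo E))).symm.trans ?_
    simp only [← Finset.sum_mul, S_sum_all hf]
    rw [Fintype.sum_eq_single (botI X)]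
    · rw [if_pos hb, hx.cf _ _ (iso_quo_bot X)]
    · intro U hU
      rw [if_neg, zero_mul]
      rwa [dm_sub_zero]
  have t3 : hm (S (cop f (X.sub (botI X)))) x (X.quo (botI X)) = hm (S f) x X := by
    have : cop f (X.sub (botI X)) = f := funext fun B => cop_zero_left hf hb B
    rw [this]
    exact hm_isCF (S_isCF hf) hx.cf _ _ (iso_quo_bot X)
  have t4 : ∑ W : Inv X, (if dm (X.sub W) = 0 then 0 else
      hm (S (cop f (X.sub W))) x (X.quo W)) = f (X.sub (botI X)) * x X - hm (S f) x X := by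
    rw [← t2, ← Finset.add_sum_erase _ _ (Finset.mem_univ (botI X)),
      ← Finset.add_sum_erase _ (fun W => hm (S (cop f (X.sub W))) x (X.quo W))
        (Finset.mem_univ (botI X)), if_pos hb, t3, zero_add, add_sub_cancel_left]
    refine Finset.sum_congr rfl fun W hW => ?_
    rw [if_neg]
    rw [dm_sub_zero]
    exact (Finset.mem_erase.1 hW).1
  rw [t1, t4, hf _ _ (iso_zero ht hb)]
  ring

theorem S_hm' {x f : Obj F → ℂ} (hx : Prim x) (hf : IsCF f) : S (hm x f) = - hm (S f) x :=
  funext fun X => S_hm hx (dm X) hf X rfl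

/-- The unit. -/
noncomputable def one : Obj F → ℂ := fun X => if dm X = 0 then 1 else 0

theorem one_isCF : IsCF (one : Obj F → ℂ) := fun X Y h => by simp only [one, h.dm_eq]

theorem one_hm {f : Obj F → ℂ} (hf : IsCF f) : hm one f = f := by
  funext X
  unfold hm
  rw [Fintype.sum_eq_single (botI X)]
  · rw [one, if_pos ((dm_sub_zero X _).2 rfl), one_mul, hf _ _ (iso_quo_bot X)]
  · intro W hW
    rw [one, if_neg, zero_mul]
    rwa [dm_sub_zero]

theorem hm_one {f : Obj F → ℂ} (hf : IsCF f) : hm f one = f := by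
  funext X
  unfold hm
  rw [Fintype.sum_eq_single (topI X)]
  · rw [one, if_pos ((dm_quo_zero X _).2 rfl), mul_one, ← hf _ _ (iso_sub_top X)]
  · intro W hW
    rw [one, if_neg, mul_zero]
    rwa [dm_quo_zero]

theorem S_one : S (one : Obj F → ℂ) = one := by
  funext X
  by_cases h : dm X = 0
  · exact S_dm_zero _ X h
  · rw [S_rec _ X h, one, if_neg h, neg_eq_zero]
    refine Finset.sum_eq_zero fun W _ => ?_
    split_ifs with hW
    · rfl
    · have : cop (one : Obj F → ℂ) (X.sub W) = 0 := by
        funext B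
        unfold cop
        rw [Finset.sum_eq_zero, mul_zero]; · rfl
        intro u _
        rw [one, if_neg]
        rw [dm_ext]; omega
      rw [this, S_zero]; rfl

theorem S_prim {x : Obj F → ℂ} (hx : Prim x) : S x = - x := by
  have := S_hm' hx one_isCF
  rwa [hm_one hx.cf, S_one, one_hm hx.cf] at this


/-! ### Matrices -/

/-- The pair attached to a matrix. -/
noncomputable abbrev mobj {ι : Type} [Fintype ι] (M : Matrix ι ι F) : Obj F :=
  ⟨ι → F, M.mulVecLin⟩

theorem mobj_T {ι : Type} [Fintype ι] (M : Matrix ι ι F) (v : ι → F) :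
    (mobj M).T v = M *ᵥ v := Matrix.mulVecLin_apply M v

theorem dm_mobj {n : ℕ} (M : gl F n) : dm (mobj M) = n := by
  change Module.finrank F (Fin n → F) = n
  simp

theorem iso_reindex {ι κ : Type} [Fintype ι] [Fintype κ] (e : ι ≃ κ) (M : Matrix ι ι F) :
    Iso (mobj (Matrix.reindex e e M)) (mobj M) := by
  refine ⟨LinearEquiv.funCongrLeft F F e, fun v => ?_⟩
  rw [mobj_T, mobj_T]
  funext i
  simp only [LinearEquiv.funCongrLeft_apply, LinearMap.funLeft_apply, Matrix.mulVec, dotProduct,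
    Matrix.reindex_apply, Matrix.submatrix_apply, Equiv.symm_apply_apply]
  symm
  refine Fintype.sum_equiv e _ _ fun j => ?_
  simp

theorem iso_castM {m n : ℕ} (h : m = n) (M : gl F m) : Iso (mobj (castM h M)) (mobj M) :=
  iso_reindex _ _

theorem iso_conj {n : ℕ} (g : Matrix.GeneralLinearGroup (Fin n) F) (x : gl F n) :
    Iso (mobj x) (mobj (conjM g x)) := by
  have h1 : (g : Matrix (Fin n) (Fin n) F) * ((g⁻¹ : Matrix.GeneralLinearGroup (Fin n) F) :
      Matrix (Fin n) (Fin n) F) = 1 := Units.mul_inv g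
  have h2 : ((g⁻¹ : Matrix.GeneralLinearGroup (Fin n) F) : Matrix (Fin n) (Fin n) F) *
      (g : Matrix (Fin n) (Fin n) F) = 1 := Units.inv_mul g
  refine ⟨Matrix.toLin'OfInv h2 h1, fun v => ?_⟩
  rw [mobj_T, mobj_T]
  change Matrix.toLin' _ _ = _ *ᵥ (Matrix.toLin' _ _)
  rw [Matrix.toLin'_apply, Matrix.toLin'_apply, Matrix.mulVec_mulVec, Matrix.mulVec_mulVec, conjM,
    Matrix.mul_assoc _ _ (g : Matrix (Fin n) (Fin n) F), h2, Matrix.mul_one]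

/-- The invertible matrix of an automorphism. -/
noncomputable def glOf {n : ℕ} (e : (Fin n → F) ≃ₗ[F] (Fin n → F)) :
    Matrix.GeneralLinearGroup (Fin n) F :=
  ⟨LinearMap.toMatrix' e.toLinearMap, LinearMap.toMatrix' e.symm.toLinearMap, by
    rw [← LinearMap.toMatrix'_comp]; simp, by
    rw [← LinearMap.toMatrix'_comp]; simp⟩

theorem glOf_mulVec {n : ℕ} (e : (Fin n → F) ≃ₗ[F] (Fin n → F)) (v : Fin n → F) :
    (glOf e : Matrix (Fin n) (Fin n) F) *ᵥ v = e v := by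
  change (LinearMap.toMatrix' e.toLinearMap) *ᵥ v = e v
  rw [← Matrix.toLin'_apply, Matrix.toLin'_toMatrix']; rfl

theorem conj_of_iso {n : ℕ} {x y : gl F n} (h : Iso (mobj x) (mobj y)) :
    ∃ g, y = conjM g x := by
  obtain ⟨e, he⟩ := h
  refine ⟨glOf e, ?_⟩
  have h1 : (glOf e : Matrix (Fin n) (Fin n) F) * (((glOf e)⁻¹ :
      Matrix.GeneralLinearGroup (Fin n) F) : Matrix (Fin n) (Fin n) F) = 1 := Units.mul_inv _
  have h2 : (glOf e : Matrix (Fin n) (Fin n) F) * x = y * glOf e := by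
    apply Matrix.toLin'.injective
    refine LinearMap.ext fun v => ?_
    have := he v
    rw [mobj_T, mobj_T] at this
    rw [Matrix.toLin'_apply, Matrix.toLin'_apply, ← Matrix.mulVec_mulVec, ← Matrix.mulVec_mulVec,
      glOf_mulVec, glOf_mulVec]
    exact this
  rw [conjM, h2, Matrix.mul_assoc, h1, Matrix.mul_one]

theorem exists_mobj (X : Obj F) {n : ℕ} (h : dm X = n) : ∃ M : gl F n, Iso X (mobj M) := by
  let e : X.V ≃ₗ[F] (Fin n → F) := (Module.finBasisOfFinrankEq F X.V h).equivFun
  refine ⟨LinearMap.toMatrix' (e.toLinearMap ∘ₗ X.T ∘ₗ e.symm.toLinearMap), e, fun v => ?_⟩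
  rw [mobj_T, ← Matrix.toLin'_apply, Matrix.toLin'_toMatrix']
  simp

/-- Extension of an invariant function to pairs. -/
noncomputable def hat (n : ℕ) (f : gl F n → ℂ) (X : Obj F) : ℂ :=
  if h : ∃ M : gl F n, Iso X (mobj M) then f h.choose else 0

theorem hat_eq {n : ℕ} {f : gl F n → ℂ} (hf : Invariant n f) {X : Obj F} {M : gl F n}
    (h : Iso X (mobj M)) : hat n f X = f M := by
  have h' : ∃ M : gl F n, Iso X (mobj M) := ⟨M, h⟩
  rw [hat, dif_pos h']
  obtain ⟨g, hg⟩ := conj_of_iso (h.symm.trans h'.choose_spec)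
  rw [hg, hf]

theorem hat_mobj {n : ℕ} {f : gl F n → ℂ} (hf : Invariant n f) (M : gl F n) :
    hat n f (mobj M) = f M := hat_eq hf (Iso.rfl' _)

theorem hat_ne {n : ℕ} (f : gl F n → ℂ) {X : Obj F} (h : dm X ≠ n) : hat n f X = 0 := by
  rw [hat, dif_neg]
  rintro ⟨M, hM⟩
  exact h (hM.dm_eq.trans (dm_mobj M))

theorem hat_isCF {n : ℕ} {f : gl F n → ℂ} (hf : Invariant n f) : IsCF (hat n f) := by
  intro X Y h
  by_cases hX : dm X = n
  · obtain ⟨M, hM⟩ := exists_mobj X hX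
    rw [hat_eq hf hM, hat_eq hf (h.symm.trans hM)]
  · rw [hat_ne f hX, hat_ne f (by rwa [← h.dm_eq])]

theorem inv_of_CF (n : ℕ) {Φ : Obj F → ℂ} (h : IsCF Φ) :
    Invariant n (fun M : gl F n => Φ (mobj M)) :=
  fun g x => (h _ _ (iso_conj g x)).symm

/-- A class function supported in dimension `n` is an extension. -/
theorem eq_hat {n : ℕ} {Φ : Obj F → ℂ} (h : IsCF Φ) (h0 : ∀ X, dm X ≠ n → Φ X = 0) :
    hat n (fun M => Φ (mobj M)) = Φ := by
  funext X
  by_cases hX : dm X = n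
  · obtain ⟨M, hM⟩ := exists_mobj X hX
    rw [hat_eq (inv_of_CF n h) hM, h _ _ hM]
  · rw [hat_ne _ hX, h0 X hX]

/-! ### Restriction -/

theorem iso_but (k l : ℕ) (x : gl F k) (u : Matrix (Fin k) (Fin l) F) (y : gl F l) :
    Iso (ext (mobj x) (mobj y) (Matrix.toLin' u)) (mobj (but k l x u y)) := by
  refine Iso.trans ?_ (iso_reindex finSumFinEquiv _).symm
  refine ⟨(LinearEquiv.prodComm F _ _).trans (LinearEquiv.sumArrowLequivProdArrow _ _ F F).symm, ?_⟩
  intro v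
  rw [mobj_T, ext_T, mobj_T, mobj_T]
  obtain ⟨b, a⟩ := v
  change Sum.elim (x *ᵥ a + Matrix.toLin' u b) (y *ᵥ b) = Matrix.fromBlocks x u 0 y *ᵥ Sum.elim a b
  rw [Matrix.fromBlocks_mulVec]
  simp [Matrix.toLin'_apply]

theorem HCres_eq (k l : ℕ) {Φ : Obj F → ℂ} (h : IsCF Φ) (x : gl F k) (y : gl F l) :
    HCres k l (fun z => Φ (mobj z)) (x, y) = cop Φ (mobj x) (mobj y) := by
  unfold HCres
  split_ifs with hk hl
  · rw [cop_zero_left h ((dm_mobj x).trans hk)]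
    exact h _ _ (iso_castM _ _)
  · rw [cop_zero_right h _ ((dm_mobj y).trans hl)]
    exact h _ _ (iso_castM _ _)
  · have hc : Fintype.card ((Fin l → F) →ₗ[F] (Fin k → F)) = Fintype.card F ^ (k * l) := by
      rw [← Fintype.card_congr (Matrix.toLin' (R := F) (m := Fin k) (n := Fin l)).toEquiv]
      change Fintype.card (Fin k → Fin l → F) = _
      rw [Fintype.card_fun, Fintype.card_fun, Fintype.card_fin, Fintype.card_fin, ← pow_mul, mul_comm]
    change _ * _ = (Fintype.card ((Fin l → F) →ₗ[F] (Fin k → F)) : ℂ)⁻¹ * _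
    rw [hc]
    push_cast
    congr 1
    refine Fintype.sum_equiv (Matrix.toLin' (R := F) (m := Fin k) (n := Fin l)).toEquiv _ _ ?_
    intro u
    exact (h _ _ (iso_but k l x u y)).symm

/-! ### Induction -/

/-- Projection to the last coordinates. -/
def prj (F : Type) [Field F] (k l : ℕ) : (Fin (k + l) → F) →ₗ[F] (Fin l → F) :=
  LinearMap.funLeft F F fun j => finSumFinEquiv (Sum.inr j)

/-- Inclusion of the first coordinates. -/
def inj (F : Type) [Field F] (k l : ℕ) : (Fin k → F) →ₗ[F] (Fin (k + l) → F) where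
  toFun v := fun i => Sum.elim v 0 (finSumFinEquiv.symm i)
  map_add' v w := by
    funext i
    obtain ⟨i, rfl⟩ := finSumFinEquiv.surjective i
    rcases i with j | j <;> simp
  map_smul' c w := by
    funext i
    obtain ⟨i, rfl⟩ := finSumFinEquiv.surjective i
    rcases i with j | j <;> simp

theorem inj_injective (k l : ℕ) : Function.Injective (inj F k l) := by
  intro v w h
  funext i
  have := congrFun h (finSumFinEquiv (Sum.inl i))
  simpa [inj] using this

theorem prj_surjective (k l : ℕ) : Function.Surjective (prj F k l) := by
  intro v
  refine ⟨fun i => Sum.elim 0 v (finSumFinEquiv.symm i), ?_⟩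
  funext j
  simp [prj, LinearMap.funLeft_apply]

theorem prj_zero (k l : ℕ) (v : Fin (k + l) → F) : prj F k l v = 0 ↔ ∃ u, inj F k l u = v := by
  constructor
  · intro h
    refine ⟨fun i => v (finSumFinEquiv (Sum.inl i)), ?_⟩
    funext i
    obtain ⟨i, rfl⟩ := finSumFinEquiv.surjective i
    change Sum.elim _ _ (finSumFinEquiv.symm (finSumFinEquiv i)) = _
    rw [Equiv.symm_apply_apply]
    rcases i with i | i
    · rfl
    · exact (congrFun h i).symm
  · rintro ⟨u, rfl⟩
    funext j
    simp [prj, inj, LinearMap.funLeft_apply]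

theorem mulVec_blk (k l : ℕ) (m : gl F (k + l)) (v : Fin (k + l) → F) (i : Fin k ⊕ Fin l) :
    (m *ᵥ v) (finSumFinEquiv i) = (blk k l m *ᵥ (fun j => v (finSumFinEquiv j))) i := by
  simp only [Matrix.mulVec, dotProduct, blk, Matrix.reindex_apply, Matrix.submatrix_apply,
    Equiv.symm_symm]
  exact (Fintype.sum_equiv finSumFinEquiv _ _ fun j => rfl).symm

theorem prj_mulVec (k l : ℕ) (m : gl F (k + l)) (hm : IsBUT k l m) (v : Fin (k + l) → F) :
    prj F k l (m *ᵥ v) = (proj k l m).2 *ᵥ prj F k l v := by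
  funext j
  refine (mulVec_blk k l m v (Sum.inr j)).trans ?_
  have h0 : ∀ i, blk k l m (Sum.inr j) (Sum.inl i) = 0 := fun i => congrFun (congrFun hm j) i
  simp only [Matrix.mulVec, dotProduct, Fintype.sum_sum_type, h0, zero_mul, Finset.sum_const_zero,
    zero_add]
  rfl

theorem mulVec_inj (k l : ℕ) (m : gl F (k + l)) (hm : IsBUT k l m) (v : Fin k → F) :
    m *ᵥ (inj F k l v) = inj F k l ((proj k l m).1 *ᵥ v) := by
  funext i
  obtain ⟨i, rfl⟩ := finSumFinEquiv.surjective i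
  rw [mulVec_blk]
  change _ = Sum.elim _ _ (finSumFinEquiv.symm (finSumFinEquiv i))
  rw [Equiv.symm_apply_apply]
  rcases i with i | i
  · simp [Matrix.mulVec, dotProduct, Fintype.sum_sum_type, inj, proj, Matrix.toBlocks₁₁]
  · have h0 : ∀ j, blk k l m (Sum.inr i) (Sum.inl j) = 0 := fun j => congrFun (congrFun hm i) j
    simp [Matrix.mulVec, dotProduct, Fintype.sum_sum_type, inj, h0]

theorem isBUT_iff (k l : ℕ) (m : gl F (k + l)) :
    IsBUT k l m ↔ ∀ v, prj F k l v = 0 → prj F k l (m *ᵥ v) = 0 := by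
  constructor
  · intro h v hv
    rw [prj_mulVec k l m h, hv, Matrix.mulVec_zero]
  · intro h
    unfold IsBUT
    ext j i
    have := congrFun (h (inj F k l (Pi.single i 1)) ((prj_zero k l _).2 ⟨_, rfl⟩)) j
    have h2 := (mulVec_blk k l m (inj F k l (Pi.single i 1)) (Sum.inr j)).symm.trans this
    have h3 : (fun j => inj F k l (Pi.single i 1) (finSumFinEquiv j)) =
        (Pi.single (Sum.inl i) 1 : Fin k ⊕ Fin l → F) := by
      funext a
      change Sum.elim _ _ (finSumFinEquiv.symm (finSumFinEquiv a)) = _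
      rw [Equiv.symm_apply_apply]
      rcases a with a | a
      · simp [Pi.single_apply]
      · simp
    rw [h3, Matrix.mulVec_single_one] at h2
    exact h2


/-- The subspace attached to a matrix. -/
def Kg (k l : ℕ) (g : gl F (k + l)) : Submodule F (Fin (k + l) → F) :=
  LinearMap.ker (prj F k l ∘ₗ g.mulVecLin)

theorem mem_Kg (k l : ℕ) (g : gl F (k + l)) (v : Fin (k + l) → F) :
    v ∈ Kg k l g ↔ prj F k l (g *ᵥ v) = 0 := Iff.rfl

theorem gl_mul_inv {n : ℕ} (g : Matrix.GeneralLinearGroup (Fin n) F) :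
    (g : Matrix (Fin n) (Fin n) F) * ((g⁻¹ : Matrix.GeneralLinearGroup (Fin n) F) :
      Matrix (Fin n) (Fin n) F) = 1 := Units.mul_inv g

theorem gl_inv_mul {n : ℕ} (g : Matrix.GeneralLinearGroup (Fin n) F) :
    ((g⁻¹ : Matrix.GeneralLinearGroup (Fin n) F) : Matrix (Fin n) (Fin n) F) *
      (g : Matrix (Fin n) (Fin n) F) = 1 := Units.inv_mul g

theorem gl_mulVec_surj {n : ℕ} (g : Matrix.GeneralLinearGroup (Fin n) F) (v : Fin n → F) :
    ∃ w, (g : Matrix (Fin n) (Fin n) F) *ᵥ w = v :=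
  ⟨((g⁻¹ : Matrix.GeneralLinearGroup (Fin n) F) : Matrix (Fin n) (Fin n) F) *ᵥ v, by
    rw [Matrix.mulVec_mulVec, gl_mul_inv, Matrix.one_mulVec]⟩

theorem finrank_Kg (k l : ℕ) (g : Matrix.GeneralLinearGroup (Fin (k + l)) F) :
    Module.finrank F (Kg k l (g : gl F (k + l))) = k := by
  have h := LinearMap.finrank_range_add_finrank_ker
    (prj F k l ∘ₗ (g : gl F (k + l)).mulVecLin)
  have h2 : LinearMap.range (prj F k l ∘ₗ (g : gl F (k + l)).mulVecLin) = ⊤ := by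
    rw [LinearMap.range_eq_top]
    exact (prj_surjective k l).comp fun v => gl_mulVec_surj g v
  rw [h2, finrank_top] at h
  simp only [Module.finrank_fin_fun] at h
  unfold Kg
  omega

theorem isBUT_iff_Kg (k l : ℕ) (g : Matrix.GeneralLinearGroup (Fin (k + l)) F) :
    IsBUT k l (g : gl F (k + l)) ↔ Kg k l (g : gl F (k + l)) = Kg k l 1 := by
  rw [isBUT_iff]
  constructor
  · intro h
    symm
    apply Submodule.eq_of_le_of_finrank_eq
    · intro v hv
      rw [mem_Kg, Matrix.one_mulVec] at hv
      exact h v hv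
    · rw [finrank_Kg]
      exact finrank_Kg k l 1
  · intro h v hv
    have : v ∈ Kg k l (1 : gl F (k + l)) := by rwa [mem_Kg, Matrix.one_mulVec]
    rw [← h] at this
    exact this

theorem Kg_mul (k l : ℕ) (g h g' : Matrix.GeneralLinearGroup (Fin (k + l)) F) :
    Kg k l ((g * h : Matrix.GeneralLinearGroup (Fin (k + l)) F) : gl F (k + l)) =
      Kg k l ((g' * h : Matrix.GeneralLinearGroup (Fin (k + l)) F) : gl F (k + l)) ↔
    Kg k l (g : gl F (k + l)) = Kg k l (g' : gl F (k + l)) := by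
  simp only [Submodule.ext_iff, mem_Kg, Units.val_mul, ← Matrix.mulVec_mulVec]
  constructor
  · intro H v
    obtain ⟨w, rfl⟩ := gl_mulVec_surj h v
    exact H w
  · intro H v
    exact H _

theorem exists_Kg (k l : ℕ) (W : Submodule F (Fin (k + l) → F)) (hW : Module.finrank F W = k) :
    ∃ g : Matrix.GeneralLinearGroup (Fin (k + l)) F, Kg k l (g : gl F (k + l)) = W := by
  obtain ⟨C, hC⟩ := W.exists_isCompl
  have hfC : Module.finrank F C = l := by
    have := Submodule.finrank_add_eq_of_isCompl hC
    rw [Module.finrank_fin_fun] at this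
    omega
  let e1 := (Submodule.prodEquivOfIsCompl W C hC).symm
  let eW : W ≃ₗ[F] (Fin k → F) := LinearEquiv.ofFinrankEq _ _ (by rw [hW]; simp)
  let eC : C ≃ₗ[F] (Fin l → F) := LinearEquiv.ofFinrankEq _ _ (by rw [hfC]; simp)
  let e : (Fin (k + l) → F) ≃ₗ[F] (Fin (k + l) → F) :=
    ((e1.trans (eW.prodCongr eC)).trans (LinearEquiv.sumArrowLequivProdArrow _ _ F F).symm).trans
      (LinearEquiv.funCongrLeft F F finSumFinEquiv.symm)
  refine ⟨glOf e, ?_⟩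
  ext v
  rw [mem_Kg, glOf_mulVec]
  have : prj F k l (e v) = eC (e1 v).2 := by
    funext j
    simp [prj, e, LinearMap.funLeft_apply]
  rw [this, LinearEquiv.map_eq_zero_iff]
  exact Submodule.prodEquivOfIsCompl_symm_apply_snd_eq_zero _ _ hC

theorem card_Kg (k l : ℕ) (W : Submodule F (Fin (k + l) → F)) (hW : Module.finrank F W = k) :
    (Finset.univ.filter fun g : Matrix.GeneralLinearGroup (Fin (k + l)) F =>
      Kg k l (g : gl F (k + l)) = W).card = Pcard F k l := by
  obtain ⟨g0, rfl⟩ := exists_Kg k l W hW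
  rw [Pcard, Nat.card_eq_fintype_card, Fintype.card_subtype]
  refine Finset.card_bij (fun g _ => g * g0⁻¹) ?_ ?_ ?_
  · intro g hg
    have hg := (Finset.mem_filter.1 hg).2
    refine Finset.mem_filter.2 ⟨Finset.mem_univ _, ?_⟩
    rw [isBUT_iff_Kg]
    have := (Kg_mul k l g g0⁻¹ g0).2 hg
    rw [mul_inv_cancel] at this
    exact this
  · intro g _ g' _ h
    exact mul_right_cancel h
  · intro p hp
    have hp := (Finset.mem_filter.1 hp).2
    rw [isBUT_iff_Kg] at hp
    refine ⟨p * g0, Finset.mem_filter.2 ⟨Finset.mem_univ _, ?_⟩, by group⟩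
    have := (Kg_mul k l p g0 1).2 hp
    rwa [one_mul] at this

theorem Pcard_ne (k l : ℕ) : (Pcard F k l : ℂ) ≠ 0 := by
  rw [Nat.cast_ne_zero, Pcard, Nat.card_eq_fintype_card]
  refine @Fintype.card_ne_zero _ _ ⟨⟨1, ?_⟩⟩
  rw [isBUT_iff_Kg]
  rfl

theorem isBUT_conj (k l : ℕ) (g : Matrix.GeneralLinearGroup (Fin (k + l)) F) (z : gl F (k + l)) :
    IsBUT k l (conjM g z) ↔ ∀ v ∈ Kg k l (g : gl F (k + l)), (mobj z).T v ∈ Kg k l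
      (g : gl F (k + l)) := by
  rw [isBUT_iff]
  have key : ∀ w, (conjM g z) *ᵥ ((g : gl F (k + l)) *ᵥ w) = (g : gl F (k + l)) *ᵥ (z *ᵥ w) := by
    intro w
    rw [conjM, Matrix.mulVec_mulVec, Matrix.mulVec_mulVec, Matrix.mul_assoc, gl_inv_mul,
      Matrix.mul_one]
  constructor
  · intro H v hv
    have := H _ ((mem_Kg k l _ _).1 hv)
    rw [key] at this
    rw [mem_Kg, mobj_T]
    exact this
  · intro H v hv
    obtain ⟨w, rfl⟩ := gl_mulVec_surj g v
    rw [key]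
    exact H w hv

theorem iso_conj_sub (k l : ℕ) (g : Matrix.GeneralLinearGroup (Fin (k + l)) F) (z : gl F (k + l))
    (hb : IsBUT k l (conjM g z)) (h : ∀ v ∈ Kg k l (g : gl F (k + l)), (mobj z).T v ∈ Kg k l
      (g : gl F (k + l))) :
    Iso (mobj (proj k l (conjM g z)).1) ((mobj z).sub ⟨Kg k l (g : gl F (k + l)), h⟩) := by
  refine iso_sub _ _ _ ((((g⁻¹ : Matrix.GeneralLinearGroup (Fin (k + l)) F) :
    gl F (k + l))).mulVecLin ∘ₗ inj F k l) ?_ ?_ ?_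
  · intro v w hvw
    apply inj_injective k l
    have := congrArg (fun t => (g : gl F (k + l)) *ᵥ t) hvw
    simpa [Matrix.mulVec_mulVec, gl_mul_inv] using this
  · intro v
    refine (mem_Kg k l _ v).trans ?_
    rw [prj_zero]
    refine exists_congr fun u => ?_
    change inj F k l u = (g : gl F (k + l)) *ᵥ v ↔ ((g⁻¹ : Matrix.GeneralLinearGroup
      (Fin (k + l)) F) : gl F (k + l)) *ᵥ inj F k l u = v
    constructor
    · intro hu
      rw [hu, Matrix.mulVec_mulVec, gl_inv_mul, Matrix.one_mulVec]
    · intro hu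
      rw [← hu, Matrix.mulVec_mulVec, gl_mul_inv, Matrix.one_mulVec]
  · intro v
    rw [mobj_T, mobj_T]
    change _ *ᵥ inj F k l _ = z *ᵥ (_ *ᵥ inj F k l v)
    rw [← mulVec_inj k l _ hb, conjM, Matrix.mulVec_mulVec, Matrix.mulVec_mulVec,
      ← Matrix.mul_assoc, ← Matrix.mul_assoc, gl_inv_mul, Matrix.one_mul]

theorem iso_conj_quo (k l : ℕ) (g : Matrix.GeneralLinearGroup (Fin (k + l)) F) (z : gl F (k + l))
    (hb : IsBUT k l (conjM g z)) (h : ∀ v ∈ Kg k l (g : gl F (k + l)), (mobj z).T v ∈ Kg k l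
      (g : gl F (k + l))) :
    Iso ((mobj z).quo ⟨Kg k l (g : gl F (k + l)), h⟩) (mobj (proj k l (conjM g z)).2) := by
  refine iso_quo _ _ _ (prj F k l ∘ₗ (g : gl F (k + l)).mulVecLin) ?_ ?_ ?_
  · exact (prj_surjective k l).comp fun v => gl_mulVec_surj g v
  · intro v
    exact Iff.rfl
  · intro v
    rw [mobj_T, mobj_T]
    change prj F k l ((g : gl F (k + l)) *ᵥ (z *ᵥ v)) = _ *ᵥ prj F k l ((g : gl F (k + l)) *ᵥ v)
    rw [← prj_mulVec k l _ hb, conjM, Matrix.mulVec_mulVec, Matrix.mulVec_mulVec,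
      Matrix.mul_assoc, gl_inv_mul, Matrix.mul_one]

theorem sum_gl (k l : ℕ) (Ψ : Submodule F (Fin (k + l) → F) → ℂ)
    (h0 : ∀ W : Submodule F (Fin (k + l) → F), Module.finrank F W ≠ k → Ψ W = 0) :
    ∑ g : Matrix.GeneralLinearGroup (Fin (k + l)) F, Ψ (Kg k l (g : gl F (k + l))) =
      Pcard F k l * ∑ W, Ψ W := by
  rw [← Finset.sum_fiberwise Finset.univ
    (fun g : Matrix.GeneralLinearGroup (Fin (k + l)) F => Kg k l (g : gl F (k + l))),
    Finset.mul_sum]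
  refine Finset.sum_congr rfl fun W _ => ?_
  have : ∀ g ∈ Finset.univ.filter (fun g : Matrix.GeneralLinearGroup (Fin (k + l)) F =>
      Kg k l (g : gl F (k + l)) = W), Ψ (Kg k l (g : gl F (k + l))) = Ψ W := by
    intro g hg
    rw [(Finset.mem_filter.1 hg).2]
  rw [Finset.sum_congr rfl this, Finset.sum_const, nsmul_eq_mul]
  by_cases hW : Module.finrank F W = k
  · rw [card_Kg k l W hW]
  · rw [h0 W hW, mul_zero, mul_zero]

theorem HCind_eq (k l : ℕ) (H : Obj F → Obj F → ℂ)
    (h1 : ∀ A A' B, Iso A A' → H A B = H A' B) (h2 : ∀ A, IsCF (H A))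
    (h3 : ∀ A B, dm A ≠ k → H A B = 0) (h4 : ∀ A B, dm B ≠ l → H A B = 0) (z : gl F (k + l)) :
    HCind k l (fun p => H (mobj p.1) (mobj p.2)) z =
      ∑ W : Inv (mobj z), H ((mobj z).sub W) ((mobj z).quo W) := by
  unfold HCind
  split_ifs with hk hl
  · rw [Fintype.sum_eq_single (botI (mobj z))]
    · refine (h1 _ _ _ (iso_zero ?_ ?_)).trans (h2 _ _ _ ?_)
      · exact (dm_mobj _).trans hk
      · exact (dm_sub_zero _ _).2 rfl
      · exact (iso_castM _ _).trans (iso_quo_bot _).symm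
    · intro W hW
      apply h3
      intro hd
      exact hW ((dm_sub_zero _ _).1 (hd.trans hk))
  · rw [Fintype.sum_eq_single (topI (mobj z))]
    · refine (h1 _ _ _ ?_).trans (h2 _ _ _ (iso_zero ?_ ?_))
      · exact (iso_castM _ _).trans (iso_sub_top _)
      · exact (dm_mobj _).trans hl
      · exact (dm_quo_zero _ _).2 rfl
    · intro W hW
      apply h4
      intro hd
      exact hW ((dm_quo_zero _ _).1 (hd.trans hl))
  · rw [sum_Inv]
    have key := sum_gl k l (fun W => if h : ∀ v ∈ W, (mobj z).T v ∈ W then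
      H ((mobj z).sub ⟨W, h⟩) ((mobj z).quo ⟨W, h⟩) else 0) (by
        intro W hW
        split_ifs with h
        · exact h3 _ _ hW
        · rfl)
    have e : ∀ g : Matrix.GeneralLinearGroup (Fin (k + l)) F,
        (if IsBUT k l (conjM g z) then
          (fun p : gl F k × gl F l => H (mobj p.1) (mobj p.2)) (proj k l (conjM g z)) else 0) =
        (if h : ∀ v ∈ Kg k l (g : gl F (k + l)), (mobj z).T v ∈ Kg k l (g : gl F (k + l)) then
          H ((mobj z).sub ⟨_, h⟩) ((mobj z).quo ⟨_, h⟩) else 0) := by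
      intro g
      by_cases hb : IsBUT k l (conjM g z)
      · have h := (isBUT_conj k l g z).1 hb
        rw [if_pos hb, dif_pos h]
        exact (h1 _ _ _ (iso_conj_sub k l g z hb h)).trans
          (h2 _ _ _ (iso_conj_quo k l g z hb h)).symm
      · rw [if_neg hb, dif_neg (fun h => hb ((isBUT_conj k l g z).2 h))]
    change (Pcard F k l : ℂ)⁻¹ * _ = _
    rw [Finset.sum_congr rfl fun g _ => e g]
    rw [inv_mul_eq_iff_eq_mul₀ (Pcard_ne k l)]
    convert key

theorem Rc_supp (L : List ℕ) : ∀ (f : Obj F → ℂ) (X : Obj F), dm X ≠ L.sum → Rc L f X = 0 := by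
  induction L with
  | nil =>
    intro f X h
    exact if_neg h
  | cons k L ih =>
    intro f X h
    refine Finset.sum_eq_zero fun W _ => ?_
    split_ifs with hk
    · apply ih
      have := dm_quo X W
      rw [List.sum_cons] at h
      omega
    · rfl

theorem castFun_CF {m n : ℕ} (h : m = n) {Φ : Obj F → ℂ} (hΦ : IsCF Φ) :
    castFun h (fun y : gl F m => Φ (mobj y)) = fun y : gl F n => Φ (mobj y) :=
  funext fun _ => hΦ _ _ (iso_castM _ _)

theorem RcompRes_eq (L : List ℕ) : ∀ {Φ : Obj F → ℂ}, IsCF Φ → ∀ M : gl F L.sum,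
    RcompRes L (fun y => Φ (mobj y)) M = Rc L Φ (mobj M) := by
  induction L with
  | nil =>
    intro Φ _ M
    rw [RcompRes, Rc]
    exact (if_pos (dm_mobj M)).symm
  | cons k L ih =>
    intro Φ hΦ M
    rw [RcompRes, castFun_CF _ hΦ]
    have e : (fun p : gl F k × gl F L.sum => RcompRes L (fun y => HCres k L.sum
        (fun y => Φ (mobj y)) (p.1, y)) p.2) = fun p => (fun A B => if dm A = k then
          Rc L (cop Φ A) B else 0) (mobj p.1) (mobj p.2) := by
      funext p
      simp only [HCres_eq k L.sum hΦ]
      rw [ih (cop_isCF hΦ _), if_pos (dm_mobj _)]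
    rw [e, castFun]
    have h1 : ∀ A A' : Obj F, Iso A A' → cop Φ A = cop Φ A' :=
      fun A A' hA => funext fun B => cop_iso hΦ hA (Iso.rfl' B)
    refine (HCind_eq k L.sum (fun A B => if dm A = k then Rc L (cop Φ A) B else 0)
      ?_ ?_ ?_ ?_ _).trans ?_
    · intro A A' B hA
      simp only [h1 _ _ hA, hA.dm_eq]
    · intro A B B' hB
      simp only [Rc_isCF L (cop_isCF hΦ A) _ _ hB]
    · intro A B hA
      exact if_neg hA
    · intro A B hB
      simp only [Rc_supp L (cop Φ A) B hB, ite_self]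
    · exact Rc_isCF (k :: L) hΦ _ _ (iso_castM _ _)

theorem Dual_eq {n : ℕ} {f : gl F n → ℂ} (hf : Invariant n f) (M : gl F n) :
    Dual n f M = (-1) ^ n * S (hat n f) (mobj M) := by
  have hΦ := hat_isCF hf
  have e : f = fun y => hat n f (mobj y) := funext fun y => (hat_mobj hf y).symm
  unfold S
  rw [dm_mobj]
  unfold Dual Sd
  rw [Finset.sum_apply, Finset.mul_sum]
  refine Finset.sum_congr rfl fun c _ => ?_
  have e2 : castFun c.blocks_sum.symm f = fun y => hat n f (mobj y) := by
    conv_lhs => rw [e]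
    exact castFun_CF _ hΦ
  rw [Pi.smul_apply, smul_eq_mul, e2, castFun, RcompRes_eq _ hΦ, Rc_isCF _ hΦ _ _ (iso_castM _ _),
    ← mul_assoc]
  congr 1
  have := c.length_le
  generalize c.length = r at *
  obtain ⟨d, hd⟩ := Nat.exists_eq_add_of_le this
  rw [hd, Nat.add_sub_cancel_left, pow_add, mul_right_comm, ← pow_add, Even.neg_one_pow ⟨_, rfl⟩,
    one_mul]

theorem Rc_supp' (L : List ℕ) : ∀ (f : Obj F → ℂ) (X : Obj F), (∀ Y, dm Y = dm X → f Y = 0) →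
    Rc L f X = 0 := by
  induction L with
  | nil =>
    intro f X h
    simp only [Rc, h X rfl, ite_self]
  | cons k L ih =>
    intro f X h
    refine Finset.sum_eq_zero fun W _ => ?_
    rw [ih, ite_self]
    intro B hB
    unfold cop
    rw [Finset.sum_eq_zero, mul_zero]
    intro u _
    apply h
    rw [dm_ext, hB, ← dm_quo X W, add_comm]

theorem S_supp {n : ℕ} {f : Obj F → ℂ} (h : ∀ X, dm X ≠ n → f X = 0) (X : Obj F)
    (hX : dm X ≠ n) : S f X = 0 := by
  unfold S Sd
  refine Finset.sum_eq_zero fun c _ => ?_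
  rw [Rc_supp', mul_zero]
  intro Y hY
  exact h Y (by rwa [hY])

theorem Dual_inv {n : ℕ} {f : gl F n → ℂ} (hf : Invariant n f) : Invariant n (Dual n f) := by
  have e : Dual n f = fun M => ((-1 : ℂ) ^ n • S (hat n f)) (mobj M) := funext (Dual_eq hf)
  rw [e]
  apply inv_of_CF
  intro X Y h
  simp only [Pi.smul_apply, S_isCF (hat_isCF hf) _ _ h]

theorem hat_Dual {n : ℕ} {f : gl F n → ℂ} (hf : Invariant n f) :
    hat n (Dual n f) = (-1 : ℂ) ^ n • S (hat n f) := by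
  have e : Dual n f = fun M => ((-1 : ℂ) ^ n • S (hat n f)) (mobj M) := funext (Dual_eq hf)
  rw [e]
  apply eq_hat
  · intro X Y h
    simp only [Pi.smul_apply, S_isCF (hat_isCF hf) _ _ h]
  · intro X hX
    rw [Pi.smul_apply, S_supp (fun X hX => hat_ne f hX) X hX, smul_zero]

theorem hm_supp {k l : ℕ} {f g : Obj F → ℂ} (hf : ∀ X, dm X ≠ k → f X = 0)
    (hg : ∀ X, dm X ≠ l → g X = 0) (X : Obj F) (hX : dm X ≠ k + l) : hm f g X = 0 := by
  refine Finset.sum_eq_zero fun W _ => ?_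
  by_cases h : dm (X.sub W) = k
  · rw [hg, mul_zero]
    have := dm_quo X W
    omega
  · rw [hf _ h, zero_mul]

theorem HCind_hm {k l : ℕ} {f : gl F k → ℂ} {g : gl F l → ℂ} (hf : Invariant k f)
    (hg : Invariant l g) (z : gl F (k + l)) :
    HCind k l (fun p => f p.1 * g p.2) z = hm (hat k f) (hat l g) (mobj z) := by
  have e : (fun p : gl F k × gl F l => f p.1 * g p.2) =
      fun p => (fun A B => hat k f A * hat l g B) (mobj p.1) (mobj p.2) := by
    funext p
    simp only [hat_mobj hf, hat_mobj hg]
  rw [e]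
  refine HCind_eq k l (fun A B => hat k f A * hat l g B) ?_ ?_ ?_ ?_ z
  · intro A A' B h
    simp only [hat_isCF hf _ _ h]
  · intro A B B' h
    simp only [hat_isCF hg _ _ h]
  · intro A B h
    simp only [hat_ne f h, zero_mul]
  · intro A B h
    simp only [hat_ne g h, mul_zero]

theorem HCind_inv {k l : ℕ} {f : gl F k → ℂ} {g : gl F l → ℂ} (hf : Invariant k f)
    (hg : Invariant l g) : Invariant (k + l) (HCind k l (fun p => f p.1 * g p.2)) := by
  rw [funext (HCind_hm hf hg)]
  exact inv_of_CF _ (hm_isCF (hat_isCF hf) (hat_isCF hg))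

theorem hat_HCind {k l : ℕ} {f : gl F k → ℂ} {g : gl F l → ℂ} (hf : Invariant k f)
    (hg : Invariant l g) :
    hat (k + l) (HCind k l (fun p => f p.1 * g p.2)) = hm (hat k f) (hat l g) := by
  rw [funext (HCind_hm hf hg)]
  exact eq_hat (hm_isCF (hat_isCF hf) (hat_isCF hg))
    (hm_supp (fun X hX => hat_ne f hX) (fun X hX => hat_ne g hX))

theorem hat_inj {n : ℕ} {f g : gl F n → ℂ} (hf : Invariant n f) (hg : Invariant n g)
    (h : hat n f = hat n g) : f = g := by
  funext M
  rw [← hat_mobj hf, h, hat_mobj hg]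

theorem hat_lin {n : ℕ} (a : ℂ) {f g : gl F n → ℂ} (hf : Invariant n f) (hg : Invariant n g)
    (h : Invariant n (a • f + g)) :
    hat n (a • f + g) = a • hat n f + hat n g := by
  funext X
  by_cases hX : dm X = n
  · obtain ⟨M, hM⟩ := exists_mobj X hX
    rw [hat_eq h hM, Pi.add_apply, Pi.smul_apply, Pi.add_apply, Pi.smul_apply, hat_eq hf hM,
      hat_eq hg hM]
  · rw [hat_ne _ hX, Pi.add_apply, Pi.smul_apply, hat_ne _ hX, hat_ne _ hX]
    simp

theorem lin_inv {n : ℕ} (a : ℂ) {f g : gl F n → ℂ} (hf : Invariant n f) (hg : Invariant n g) :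
    Invariant n (a • f + g) := by
  intro x y
  simp only [Pi.add_apply, Pi.smul_apply, hf x y, hg x y]

theorem precusp_iff_cop {n : ℕ} {f : gl F n → ℂ} (hf : Invariant n f) :
    PreCuspidal n f ↔ ∀ A B : Obj F, dm A ≠ 0 → dm B ≠ 0 → cop (hat n f) A B = 0 := by
  have e : f = fun y => hat n f (mobj y) := funext fun y => (hat_mobj hf y).symm
  have key : ∀ k l (h : k + l = n) (x : gl F k) (y : gl F l),
      HCres k l (castFun h.symm f) (x, y) = cop (hat n f) (mobj x) (mobj y) := by
    intro k l h x y
    have e2 : castFun h.symm f = fun y => hat n f (mobj y) := by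
      conv_lhs => rw [e]
      exact castFun_CF _ (hat_isCF hf)
    rw [e2, HCres_eq k l (hat_isCF hf)]
  constructor
  · intro h A B hA hB
    by_cases hn : dm A + dm B = n
    · obtain ⟨x, hx⟩ := exists_mobj A rfl
      obtain ⟨y, hy⟩ := exists_mobj B rfl
      rw [cop_iso (hat_isCF hf) hx hy, ← key _ _ hn,
        h (dm A) (dm B) (by omega) (by omega) hn]
      rfl
    · unfold cop
      rw [Finset.sum_eq_zero, mul_zero]
      intro u _
      apply hat_ne
      rwa [dm_ext]
  · intro h k l hk hl hkl
    funext p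
    obtain ⟨x, y⟩ := p
    rw [key k l hkl]
    exact h _ _ (by rw [dm_mobj]; omega) (by rw [dm_mobj]; omega)

theorem prim_hat {n : ℕ} (hn : 1 ≤ n) {f : gl F n → ℂ} (hf : Invariant n f)
    (hc : PreCuspidal n f) : Prim (hat n f) :=
  ⟨hat_isCF hf, fun X hX => hat_ne f (by omega), (precusp_iff_cop hf).1 hc⟩


/-! ### Adjunction -/

theorem conj_sum_inv {n : ℕ} (g : Matrix.GeneralLinearGroup (Fin n) F) (G : gl F n → ℂ) :
    ∑ z, G (conjM g z) = ∑ z, G z := by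
  have hi : Function.Injective (conjM g : gl F n → gl F n) := by
    intro x y h
    have h2 := congrArg (conjM g⁻¹) h
    have key : ∀ x : gl F n, conjM g⁻¹ (conjM g x) = x := by
      intro x
      unfold conjM
      rw [inv_inv, Matrix.mul_assoc, Matrix.mul_assoc, gl_inv_mul, Matrix.mul_one,
        ← Matrix.mul_assoc, gl_inv_mul, Matrix.one_mul]
    rwa [key, key] at h2
  exact Fintype.sum_bijective _ (Finite.injective_iff_bijective.1 hi) _ _ fun _ => rfl

theorem proj_but (k l : ℕ) (x : gl F k) (u : Matrix (Fin k) (Fin l) F) (y : gl F l) :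
    proj k l (but k l x u y) = (x, y) := by
  simp [proj, but, blk]

theorem isBUT_but (k l : ℕ) (x : gl F k) (u : Matrix (Fin k) (Fin l) F) (y : gl F l) :
    IsBUT k l (but k l x u y) := by
  simp [IsBUT, but, blk]

theorem but_of_isBUT (k l : ℕ) (m : gl F (k + l)) (h : IsBUT k l m) :
    but k l (proj k l m).1 (Matrix.toBlocks₁₂ (blk k l m)) (proj k l m).2 = m := by
  have : Matrix.fromBlocks (proj k l m).1 (Matrix.toBlocks₁₂ (blk k l m)) 0 (proj k l m).2 =
      blk k l m := by
    rw [← h]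
    exact Matrix.fromBlocks_toBlocks _
  rw [but, this]
  simp [blk]

theorem sum_but (k l : ℕ) (G : gl F (k + l) → ℂ) :
    ∑ z, (if IsBUT k l z then G z else 0) =
      ∑ p : gl F k × gl F l, ∑ u : Matrix (Fin k) (Fin l) F, G (but k l p.1 u p.2) := by
  rw [← Finset.sum_filter]
  symm
  refine (Finset.sum_product' Finset.univ Finset.univ
    (fun (p : gl F k × gl F l) (u : Matrix (Fin k) (Fin l) F) => G (but k l p.1 u p.2))).symm.trans ?_
  refine Finset.sum_bij (fun q _ => but k l q.1.1 q.2 q.1.2) ?_ ?_ ?_ (fun _ _ => rfl)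
  · intro q _
    exact Finset.mem_filter.2 ⟨Finset.mem_univ _, isBUT_but _ _ _ _ _⟩
  · rintro ⟨⟨x, y⟩, u⟩ _ ⟨⟨x', y'⟩, u'⟩ _ h
    have h1 : Matrix.fromBlocks x u 0 y = Matrix.fromBlocks x' u' 0 y' :=
      (Matrix.reindex finSumFinEquiv finSumFinEquiv).injective h
    obtain ⟨rfl, rfl, _, rfl⟩ := Matrix.fromBlocks_inj.1 h1
    rfl
  · intro m hm
    have hm := (Finset.mem_filter.1 hm).2
    exact ⟨(proj k l m, Matrix.toBlocks₁₂ (blk k l m)), Finset.mem_product.2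
      ⟨Finset.mem_univ _, Finset.mem_univ _⟩, but_of_isBUT k l m hm⟩

theorem adj (k l : ℕ) (hk : 1 ≤ k) (hl : 1 ≤ l) : ∃ c : ℂ, c ≠ 0 ∧
    ∀ (h : gl F k × gl F l → ℂ) (r : gl F (k + l) → ℂ), Invariant (k + l) r →
      ∑ z, HCind k l h z * r z = c * ∑ p, h p * HCres k l r p := by
  have hq : (Fintype.card F : ℂ) ≠ 0 := Nat.cast_ne_zero.2 Fintype.card_ne_zero
  have hG : (Fintype.card (Matrix.GeneralLinearGroup (Fin (k + l)) F) : ℂ) ≠ 0 :=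
    Nat.cast_ne_zero.2 Fintype.card_ne_zero
  refine ⟨(Pcard F k l : ℂ)⁻¹ * Fintype.card (Matrix.GeneralLinearGroup (Fin (k + l)) F) *
    (Fintype.card F : ℂ) ^ (k * l), mul_ne_zero (mul_ne_zero (inv_ne_zero (Pcard_ne k l)) hG)
      (pow_ne_zero _ hq), ?_⟩
  intro h r hr
  have e1 : ∀ z, HCind k l h z = (Pcard F k l : ℂ)⁻¹ *
      ∑ g : Matrix.GeneralLinearGroup (Fin (k + l)) F,
        if IsBUT k l (conjM g z) then h (proj k l (conjM g z)) else 0 := by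
    intro z
    rw [HCind, dif_neg (by omega), dif_neg (by omega)]
  have e2 : ∀ p, HCres k l r p = ((Fintype.card F : ℂ) ^ (k * l))⁻¹ *
      ∑ u : Matrix (Fin k) (Fin l) F, r (but k l p.1 u p.2) := by
    intro p
    rw [HCres, dif_neg (by omega), dif_neg (by omega)]
  have e3 : ∑ z, HCind k l h z * r z = (Pcard F k l : ℂ)⁻¹ *
      (Fintype.card (Matrix.GeneralLinearGroup (Fin (k + l)) F) *
        ∑ z, if IsBUT k l z then h (proj k l z) * r z else 0) := by
    simp only [e1, mul_assoc, ← Finset.mul_sum, Finset.sum_mul]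
    congr 1
    rw [Finset.sum_comm]
    have : ∀ g : Matrix.GeneralLinearGroup (Fin (k + l)) F,
        ∑ z, (if IsBUT k l (conjM g z) then h (proj k l (conjM g z)) else 0) * r z =
        ∑ z, if IsBUT k l z then h (proj k l z) * r z else 0 := by
      intro g
      refine Eq.trans ?_ (conj_sum_inv g
        (fun z => if IsBUT k l z then h (proj k l z) * r z else 0))
      refine Finset.sum_congr rfl fun z _ => ?_
      simp only [hr g z]
      split_ifs <;> simp
    rw [Finset.sum_congr rfl fun g _ => this g, Finset.sum_const, nsmul_eq_mul, Finset.card_univ]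
  rw [e3, sum_but]
  simp only [e2, proj_but, Finset.mul_sum]
  refine Finset.sum_congr rfl fun p _ => Finset.sum_congr rfl fun u _ => ?_
  have := pow_ne_zero (k * l) hq
  field_simp

theorem cop_conj (Z : Obj F → ℂ) (A B : Obj F) :
    cop (fun X => (starRingEnd ℂ) (Z X)) A B = (starRingEnd ℂ) (cop Z A B) := by
  simp [cop, map_sum]

theorem adj' (k l : ℕ) (hk : 1 ≤ k) (hl : 1 ≤ l) : ∃ c : ℂ, c ≠ 0 ∧
    ∀ (h : gl F k × gl F l → ℂ) (Z : Obj F → ℂ), IsCF Z →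
      ∑ z, HCind k l h z * (starRingEnd ℂ) (Z (mobj z)) =
        c * ∑ p, h p * (starRingEnd ℂ) (cop Z (mobj p.1) (mobj p.2)) := by
  obtain ⟨c, hc, H⟩ := adj (F := F) k l hk hl
  refine ⟨c, hc, fun h Z hZ => ?_⟩
  have hZ' : IsCF (fun X => (starRingEnd ℂ) (Z X)) := fun X Y hXY => by
    simp only [hZ _ _ hXY]
  rw [H h _ (inv_of_CF _ hZ')]
  congr 1
  refine Finset.sum_congr rfl fun p _ => ?_
  obtain ⟨x, y⟩ := p
  rw [HCres_eq k l hZ', cop_conj]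

theorem sum_conj_zero {ι : Type} [Fintype ι] (r : ι → ℂ)
    (h : ∑ i, r i * (starRingEnd ℂ) (r i) = 0) : r = 0 := by
  have h1 : ∑ i, Complex.normSq (r i) = 0 := by
    have : ((∑ i, Complex.normSq (r i) : ℝ) : ℂ) = 0 := by
      push_cast
      rw [← h]
      exact Finset.sum_congr rfl fun i _ => (Complex.mul_conj _).symm
    exact_mod_cast this
  have h2 := (Finset.sum_eq_zero_iff_of_nonneg fun i _ => Complex.normSq_nonneg (r i)).1 h1
  funext i
  exact Complex.normSq_eq_zero.1 (h2 i (Finset.mem_univ i))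

theorem decomp {ι : Type} [Fintype ι] (P : Submodule ℂ (ι → ℂ)) (f : ι → ℂ) :
    ∃ p ∈ P, ∀ s ∈ P, ∑ i, s i * (starRingEnd ℂ) ((f - p) i) = 0 := by
  let K : Submodule ℂ (EuclideanSpace ℂ ι) :=
    P.comap (WithLp.linearEquiv 2 ℂ (ι → ℂ)).toLinearMap
  obtain ⟨y, hy, z, hz, hv⟩ := K.exists_add_mem_mem_orthogonal (WithLp.toLp 2 f)
  refine ⟨WithLp.ofLp y, hy, fun s hs => ?_⟩
  have hz' : ∀ i, z i = (f - WithLp.ofLp y) i := by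
    intro i
    have := congrArg (fun w : EuclideanSpace ℂ ι => w i) hv
    simp only [PiLp.add_apply] at this
    rw [Pi.sub_apply]
    exact eq_sub_of_add_eq' this.symm
  have h1 : inner ℂ z (WithLp.toLp 2 s : EuclideanSpace ℂ ι) = 0 :=
    (Submodule.mem_orthogonal' K z).1 hz _ hs
  rw [PiLp.inner_apply] at h1
  rw [← h1]
  refine Finset.sum_congr rfl fun i _ => ?_
  rw [← hz' i]
  simp

/-! ### Generation by pre-cuspidal functions -/

theorem castFun_self {n : ℕ} (h : n = n) (f : gl F n → ℂ) : castFun h f = f := by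
  funext x
  simp [castFun, castM]

theorem cop_zero_of_orth {Z : Obj F → ℂ} (hCF : IsCF Z) {A B : Obj F} (hA : dm A ≠ 0)
    (hB : dm B ≠ 0)
    (horth : ∀ (f : gl F (dm A) → ℂ) (g : gl F (dm B) → ℂ), Invariant (dm A) f →
      Invariant (dm B) g → ∑ z, HCind (dm A) (dm B) (fun p => f p.1 * g p.2) z *
        (starRingEnd ℂ) (Z (mobj z)) = 0) : cop Z A B = 0 := by
  have icf : ∀ C : Obj F, IsCF (fun X => if Iso X C then (1 : ℂ) else 0) := by
    intro C X Y h
    have : Iso X C ↔ Iso Y C := ⟨fun h' => h.symm.trans h', fun h' => h.trans h'⟩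
    simp only [this]
  have j1 := inv_of_CF (dm A) (icf A)
  have j2 := inv_of_CF (dm B) (icf B)
  have hmem := horth (fun x => if Iso (mobj x) A then (1 : ℂ) else 0)
    (fun x => if Iso (mobj x) B then (1 : ℂ) else 0) j1 j2
  obtain ⟨c, hc0, hadj⟩ := adj' (F := F) (dm A) (dm B) (by omega) (by omega)
  rw [hadj _ Z hCF] at hmem
  have hsum := (mul_eq_zero.1 hmem).resolve_left hc0
  have e : ∀ p : gl F (dm A) × gl F (dm B), (if Iso (mobj p.1) A then (1 : ℂ) else 0) *
    (if Iso (mobj p.2) B then (1 : ℂ) else 0) * (starRingEnd ℂ) (cop Z (mobj p.1) (mobj p.2)) =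
      (if Iso (mobj p.1) A ∧ Iso (mobj p.2) B then (1 : ℂ) else 0) *
        (starRingEnd ℂ) (cop Z A B) := by
    intro p
    by_cases h1 : Iso (mobj p.1) A
    · by_cases h2 : Iso (mobj p.2) B
      · simp only [h1, h2, if_true, cop_iso hCF h1 h2, and_self, mul_one]
      · simp [h2]
    · simp [h1]
  rw [Finset.sum_congr rfl fun p _ => e p, ← Finset.sum_mul, Finset.sum_boole] at hsum
  obtain ⟨x, hx⟩ := exists_mobj A rfl
  obtain ⟨y, hy⟩ := exists_mobj B rfl
  rcases mul_eq_zero.1 hsum with h | h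
  · rw [Nat.cast_eq_zero, Finset.card_eq_zero] at h
    have : (x, y) ∈ (∅ : Finset (gl F (dm A) × gl F (dm B))) := by
      rw [← h]
      exact Finset.mem_filter.2 ⟨Finset.mem_univ _, hx.symm, hy.symm⟩
    simp at this
  · exact (map_eq_zero _).1 h

theorem gen (Q : ∀ n : ℕ, (gl F n → ℂ) → Prop) (h0 : ∀ f, Invariant 0 f → Q 0 f)
    (hc : ∀ n, 1 ≤ n → ∀ f, Invariant n f → PreCuspidal n f → Q n f)
    (hl : ∀ n (a : ℂ) f g, Invariant n f → Invariant n g → Q n f → Q n g → Q n (a • f + g))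
    (hp : ∀ k l, 1 ≤ k → 1 ≤ l → ∀ f g, Invariant k f → Invariant l g → Q k f → Q l g →
      Q (k + l) (HCind k l fun p => f p.1 * g p.2)) :
    ∀ n f, Invariant n f → Q n f := by
  intro n
  induction n using Nat.strong_induction_on with
  | _ n ih =>
  intro f hf
  rcases Nat.eq_zero_or_pos n with rfl | hn
  · exact h0 f hf
  have i0 : Invariant n (0 : gl F n → ℂ) := fun _ _ => rfl
  have q0 : Q n 0 := by
    refine hc n hn 0 i0 ((precusp_iff_cop i0).2 fun A B _ _ => ?_)
    have : hat n (0 : gl F n → ℂ) = 0 := by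
      funext X
      simp [hat]
    simp [this, cop]
  let P : Submodule ℂ (gl F n → ℂ) :=
    { carrier := {f | Invariant n f ∧ Q n f}
      add_mem' := by
        rintro a b ⟨ha, ha'⟩ ⟨hb, hb'⟩
        have h1 := lin_inv 1 ha hb
        have h2 := hl n 1 a b ha hb ha' hb'
        rw [one_smul] at h1 h2
        exact ⟨h1, h2⟩
      zero_mem' := ⟨i0, q0⟩
      smul_mem' := by
        rintro c a ⟨ha, ha'⟩
        have h1 := lin_inv c ha i0
        have h2 := hl n c a 0 ha i0 ha' q0
        rw [add_zero] at h1 h2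
        exact ⟨h1, h2⟩ }
  obtain ⟨p, hpP, horth⟩ := decomp P f
  have hr : Invariant n (f - p) := by
    intro g x
    rw [Pi.sub_apply, Pi.sub_apply, hf g x, hpP.1 g x]
  have hrP : f - p ∈ P := by
    refine ⟨hr, hc n hn _ hr ?_⟩
    rw [precusp_iff_cop hr]
    intro A B hA hB
    by_cases hd : dm A + dm B = n
    swap
    · unfold cop
      rw [Finset.sum_eq_zero, mul_zero]
      intro u _
      apply hat_ne
      rwa [dm_ext]
    have hfp : ∀ M, (f - p) M = hat n (f - p) (mobj M) := fun M => (hat_mobj hr M).symm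
    simp only [hfp] at horth
    have hCF := hat_isCF hr
    generalize hat n (f - p) = Z at hCF horth ⊢
    clear hr hfp
    have key : ∀ s : gl F n → ℂ, Invariant n s → Q n s →
        ∑ z, s z * (starRingEnd ℂ) (Z (mobj z)) = 0 := fun s h1 h2 => horth s ⟨h1, h2⟩
    clear horth
    refine cop_zero_of_orth hCF hA hB ?_
    intro u v hu hv
    have k1 := ih (dm A) (by omega) u hu
    have k2 := ih (dm B) (by omega) v hv
    have k3 := hp (dm A) (dm B) (by omega) (by omega) u v hu hv k1 k2
    have k4 := HCind_inv hu hv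
    clear_value P
    clear hpP ih
    subst hd
    exact key _ k4 k3
  have hz := sum_conj_zero (f - p) (horth _ hrP)
  rw [sub_eq_zero] at hz
  rw [hz]
  exact hpP.2

/-! ### Commutativity -/

theorem hm_lin_left (a : ℂ) (f g h : Obj F → ℂ) : hm (a • f + g) h = a • hm f h + hm g h := by
  funext X
  simp only [hm, Pi.add_apply, Pi.smul_apply, smul_eq_mul, add_mul, Finset.sum_add_distrib,
    Finset.mul_sum, mul_assoc]

theorem hm_lin_right (a : ℂ) (f g h : Obj F → ℂ) : hm h (a • f + g) = a • hm h f + hm h g := by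
  funext X
  simp only [hm, Pi.add_apply, Pi.smul_apply, smul_eq_mul, mul_add, Finset.sum_add_distrib,
    Finset.mul_sum, mul_left_comm]

theorem hm_smul_left (a : ℂ) (f h : Obj F → ℂ) : hm (a • f) h = a • hm f h := by
  funext X
  simp only [hm, Pi.smul_apply, smul_eq_mul, Finset.mul_sum, mul_assoc]

theorem hm_smul_right (a : ℂ) (f h : Obj F → ℂ) : hm h (a • f) = a • hm h f := by
  funext X
  simp only [hm, Pi.smul_apply, smul_eq_mul, Finset.mul_sum, mul_left_comm]

theorem hat_zero {f : gl F 0 → ℂ} (hf : Invariant 0 f) : hat 0 f = f 0 • one := by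
  funext X
  by_cases hX : dm X = 0
  · obtain ⟨M, hM⟩ := exists_mobj X hX
    rw [hat_eq hf hM, Pi.smul_apply, one, if_pos hX, smul_eq_mul, mul_one]
    congr 1
    exact Subsingleton.elim _ _
  · rw [hat_ne _ hX, Pi.smul_apply, one, if_neg hX, smul_zero]

theorem cop_hm_prim {x y : Obj F → ℂ} (hx : Prim x) (hy : Prim y) {A B : Obj F} (hA : dm A ≠ 0)
    (hB : dm B ≠ 0) : cop (hm x y) A B = x A * y B + x B * y A := by
  rw [cop_hm hx hy.cf]
  congr 1
  · rw [Fintype.sum_eq_single (topI A)]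
    · rw [cop_zero_left hy.cf ((dm_quo_zero A _).2 rfl), ← hx.cf _ _ (iso_sub_top A)]
    · intro U hU
      rw [hy.prim _ _ _ hB, mul_zero]
      intro h
      exact hU ((dm_quo_zero A U).1 h)
  · rw [Fintype.sum_eq_single (topI B)]
    · rw [cop_zero_right hy.cf _ ((dm_quo_zero B _).2 rfl), ← hx.cf _ _ (iso_sub_top B)]
    · intro U hU
      rw [hy.prim _ _ hA, mul_zero]
      intro h
      exact hU ((dm_quo_zero B U).1 h)

theorem pairing_zero {k l n : ℕ} (hk : 1 ≤ k) (hl : 1 ≤ l) (hn : k + l = n) {f : gl F k → ℂ}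
    {g : gl F l → ℂ} (hf : Invariant k f) (hg : Invariant l g) {Z : Obj F → ℂ} (hZ : IsCF Z)
    (h0 : ∀ A B : Obj F, dm A ≠ 0 → dm B ≠ 0 → cop Z A B = 0) :
    ∑ M : gl F n, hm (hat k f) (hat l g) (mobj M) * (starRingEnd ℂ) (Z (mobj M)) = 0 := by
  subst hn
  obtain ⟨c, _, hadj⟩ := adj' (F := F) k l hk hl
  have := hadj (fun p => f p.1 * g p.2) Z hZ
  simp only [HCind_hm hf hg] at this
  rw [this, Finset.sum_eq_zero, mul_zero]
  intro p _
  rw [h0, map_zero, mul_zero]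
  · rw [dm_mobj]; omega
  · rw [dm_mobj]; omega

theorem cop_sub (f g : Obj F → ℂ) (A B : Obj F) :
    cop (f - g) A B = cop f A B - cop g A B := by
  simp only [cop, Pi.sub_apply, Finset.sum_sub_distrib, mul_sub]

theorem comm_prim {k l : ℕ} (hk : 1 ≤ k) (hl : 1 ≤ l) {f : gl F k → ℂ}
    {g : gl F l → ℂ} (hf : Invariant k f) (hg : Invariant l g) (cf : PreCuspidal k f)
    (cg : PreCuspidal l g) : hm (hat k f) (hat l g) = hm (hat l g) (hat k f) := by
  have px := prim_hat hk hf cf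
  have py := prim_hat hl hg cg
  let Z : Obj F → ℂ := hm (hat k f) (hat l g) - hm (hat l g) (hat k f)
  have hZ : IsCF Z := by
    intro X Y h
    change hm (hat k f) (hat l g) X - hm (hat l g) (hat k f) X =
      hm (hat k f) (hat l g) Y - hm (hat l g) (hat k f) Y
    rw [hm_isCF px.cf py.cf _ _ h, hm_isCF py.cf px.cf _ _ h]
  have h0 : ∀ A B : Obj F, dm A ≠ 0 → dm B ≠ 0 → cop Z A B = 0 := by
    intro A B hA hB
    rw [cop_sub, cop_hm_prim px py hA hB, cop_hm_prim py px hA hB]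
    ring
  have hs : (fun M : gl F (k + l) => Z (mobj M)) = 0 := by
    apply sum_conj_zero
    have e1 := pairing_zero hk hl rfl hf hg hZ h0
    have e2 := pairing_zero hl hk (add_comm l k) hg hf hZ h0
    rw [← sub_eq_zero.2 (e1.trans e2.symm), ← Finset.sum_sub_distrib]
    refine Finset.sum_congr rfl fun M _ => ?_
    rw [← sub_mul]
    rfl
  have hZ0 : Z = 0 := by
    rw [← eq_hat (n := k + l) hZ, hs]
    · funext X
      simp [hat]
    · intro X hX
      change hm (hat k f) (hat l g) X - hm (hat l g) (hat k f) X = 0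
      rw [hm_supp (fun X hX => hat_ne f hX) (fun X hX => hat_ne g hX) X hX,
        hm_supp (fun X hX => hat_ne g hX) (fun X hX => hat_ne f hX) X (by omega), sub_zero]
  exact sub_eq_zero.1 hZ0

theorem comm_all (n : ℕ) (f : gl F n → ℂ) (hf : Invariant n f) :
    ∀ (m : ℕ) (g : gl F m → ℂ), Invariant m g →
      hm (hat n f) (hat m g) = hm (hat m g) (hat n f) := by
  refine gen (fun n f => ∀ (m : ℕ) (g : gl F m → ℂ), Invariant m g →
      hm (hat n f) (hat m g) = hm (hat m g) (hat n f)) ?_ ?_ ?_ ?_ n f hf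
  · intro f hf m g hg
    rw [hat_zero hf, hm_smul_left, hm_smul_right, one_hm (hat_isCF hg), hm_one (hat_isCF hg)]
  · intro k hk f hf cf
    refine gen (fun m g => hm (hat k f) (hat m g) = hm (hat m g) (hat k f)) ?_ ?_ ?_ ?_
    · intro g hg
      rw [hat_zero hg, hm_smul_left, hm_smul_right, one_hm (hat_isCF hf), hm_one (hat_isCF hf)]
    · intro l hl g hg cg
      exact comm_prim hk hl hf hg cf cg
    · intro n a g g' hg hg' h h'
      rw [hat_lin a hg hg' (lin_inv a hg hg'), hm_lin_left, hm_lin_right, h, h']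
    · intro p q _ _ g g' hg hg' h h'
      rw [hat_HCind hg hg', ← hm_assoc (hat_isCF hf) (hat_isCF hg) (hat_isCF hg'), h,
        hm_assoc (hat_isCF hg) (hat_isCF hf) (hat_isCF hg'), h',
        hm_assoc (hat_isCF hg) (hat_isCF hg') (hat_isCF hf)]
  · intro n a f f' hf hf' h h' m g hg
    rw [hat_lin a hf hf' (lin_inv a hf hf'), hm_lin_left, hm_lin_right, h m g hg, h' m g hg]
  · intro p q _ _ f f' hf hf' h h' m g hg
    rw [hat_HCind hf hf', ← hm_assoc (hat_isCF hg) (hat_isCF hf) (hat_isCF hf'), ← h m g hg,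
        hm_assoc (hat_isCF hf) (hat_isCF hg) (hat_isCF hf'), ← h' m g hg,
        hm_assoc (hat_isCF hf) (hat_isCF hf') (hat_isCF hg)]

theorem S_mul (n : ℕ) (f : gl F n → ℂ) (hf : Invariant n f) :
    ∀ g : Obj F → ℂ, IsCF g → S (hm (hat n f) g) = hm (S g) (S (hat n f)) := by
  refine gen (fun n f => ∀ g : Obj F → ℂ, IsCF g →
    S (hm (hat n f) g) = hm (S g) (S (hat n f))) ?_ ?_ ?_ ?_ n f hf
  · intro f hf g hg
    rw [hat_zero hf, hm_smul_left, one_hm hg, S_smul, S_smul, S_one, hm_smul_right,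
      hm_one (S_isCF hg)]
  · intro n hn f hf cf g hg
    have px := prim_hat hn hf cf
    rw [S_hm' px hg, S_prim px, ← neg_one_smul ℂ (hat n f), hm_smul_right, neg_one_smul]
  · intro n a f f' hf hf' h h' g hg
    rw [hat_lin a hf hf' (lin_inv a hf hf'), hm_lin_left, S_add, S_smul, h g hg, h' g hg, S_add,
      S_smul, hm_lin_right]
  · intro p q _ _ f f' hf hf' h h' g hg
    rw [hat_HCind hf hf', hm_assoc (hat_isCF hf) (hat_isCF hf') hg,
      h _ (hm_isCF (hat_isCF hf') hg), h' g hg, h _ (hat_isCF hf'),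
      hm_assoc (S_isCF hg) (S_isCF (hat_isCF hf')) (S_isCF (hat_isCF hf))]

theorem Dual_HCind {k l : ℕ} {f : gl F k → ℂ} {g : gl F l → ℂ} (hf : Invariant k f)
    (hg : Invariant l g) : Dual (k + l) (HCind k l fun p => f p.1 * g p.2) =
      HCind k l fun p => Dual k f p.1 * Dual l g p.2 := by
  apply hat_inj (Dual_inv (HCind_inv hf hg)) (HCind_inv (Dual_inv hf) (Dual_inv hg))
  rw [hat_Dual (HCind_inv hf hg), hat_HCind hf hg, S_mul k f hf _ (hat_isCF hg),
    hat_HCind (Dual_inv hf) (Dual_inv hg), comm_all k _ (Dual_inv hf) l _ (Dual_inv hg),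
    hat_Dual hf, hat_Dual hg, hm_smul_left, hm_smul_right, smul_smul, pow_add, mul_comm]

theorem Dual_lin {n : ℕ} (a : ℂ) {f g : gl F n → ℂ} (hf : Invariant n f) (hg : Invariant n g) :
    Dual n (a • f + g) = a • Dual n f + Dual n g := by
  funext M
  rw [Pi.add_apply, Pi.smul_apply, Dual_eq (lin_inv a hf hg), Dual_eq hf, Dual_eq hg,
    hat_lin a hf hg (lin_inv a hf hg), S_add, S_smul, Pi.add_apply, Pi.smul_apply, smul_eq_mul,
    smul_eq_mul]
  ring

theorem Dual_cusp {n : ℕ} (hn : 1 ≤ n) {f : gl F n → ℂ} (hf : Invariant n f)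
    (hc : PreCuspidal n f) : Dual n f = ((-1 : ℂ)) ^ (n - 1) • f := by
  funext M
  rw [Dual_eq hf, S_prim (prim_hat hn hf hc), Pi.neg_apply, hat_mobj hf, Pi.smul_apply,
    smul_eq_mul]
  obtain ⟨m, rfl⟩ := Nat.exists_eq_add_of_le hn
  rw [Nat.add_sub_cancel_left, pow_add]
  ring

theorem Dual_zero {f : gl F 0 → ℂ} (hf : Invariant 0 f) : Dual 0 f = f := by
  funext M
  rw [Dual_eq hf, S_dm_zero _ _ (dm_mobj M), hat_mobj hf]
  simp

/-- characterisation of the duality operations: any collection of linear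
endomorphisms of the spaces `C_n` which commutes with Harish-Chandra induction, is the
identity in degree `0`, and acts by `(-1)^{n-1}` on pre-cuspidal functions, coincides
with the duality operations `𝒟_n`. -/
theorem dual_characterisation (F : Type) [Field F] [Fintype F] [DecidableEq F]
    (D : ∀ n : ℕ, (gl F n → ℂ) → (gl F n → ℂ))
    (hmap : ∀ (n : ℕ) (f : gl F n → ℂ), Invariant n f → Invariant n (D n f))
    (hlin : ∀ (n : ℕ) (a : ℂ) (f g : gl F n → ℂ), Invariant n f → Invariant n g →
      D n (a • f + g) = a • D n f + D n g)
    (hzero : ∀ f : gl F 0 → ℂ, D 0 f = f)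
    (hind : ∀ (n₁ n₂ : ℕ), 1 ≤ n₁ → 1 ≤ n₂ →
      ∀ (f₁ : gl F n₁ → ℂ) (f₂ : gl F n₂ → ℂ), Invariant n₁ f₁ → Invariant n₂ f₂ →
      D (n₁ + n₂) (HCind n₁ n₂ fun p => f₁ p.1 * f₂ p.2) =
        HCind n₁ n₂ fun p => D n₁ f₁ p.1 * D n₂ f₂ p.2)
    (hcusp : ∀ (n : ℕ), 1 ≤ n → ∀ f : gl F n → ℂ, Invariant n f → PreCuspidal n f →
      D n f = ((-1 : ℂ)) ^ (n - 1) • f) :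
    ∀ (n : ℕ) (f : gl F n → ℂ), Invariant n f → D n f = Dual n f := by
  refine gen (fun n f => D n f = Dual n f) ?_ ?_ ?_ ?_
  · intro f hf
    rw [hzero, Dual_zero hf]
  · intro n hn f hf hc
    rw [hcusp n hn f hf hc, Dual_cusp hn hf hc]
  · intro n a f g hf hg h1 h2
    rw [hlin n a f g hf hg, h1, h2, Dual_lin a hf hg]
  · intro k l hk hl f g hf hg h1 h2
    rw [hind k l hk hl f g hf hg, h1, h2, Dual_HCind hf hg]

end HCPaper
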